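/- arXiv:2404.11186 — 7 statements merged into one kernel-verified Lean document; each statement's English description precedes it below -/
import Mathlib

section
/- Let G be a finite non-cyclic group. Then the hypergraph obtained from the global generating hypergraph Δ(G) by removing its isolated vertices is connected: for any two elements x, y of G not lying in Frat(G), there is a finite sequence x = z_0, z_1, …, z_k = y of distinct elements of G such that for each index 0 ≤ i < k there exists a minimal generating set of G containing both z_i and z_{i+1}. -/
/-- A subset `S` of a group is a minimal generating set if it generates the whole
group but no proper subset obtained by removing one element does. -/
def IsMinimalGeneratingSet {G : Type*} [Group G] (S : Set G) : Prop :=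
  Subgroup.closure S = ⊤ ∧ ∀ s ∈ S, Subgroup.closure (S \ {s}) ≠ ⊤

/-- `minGen G = d(G)` is the minimal size of a generating set of `G`. -/
noncomputable def minGen (G : Type*) [Group G] : ℕ :=
  sInf {n | ∃ S : Finset G, S.card = n ∧ Subgroup.closure (S : Set G) = ⊤}

/-- The minimal generating set exchange property (MGSE): whenever
`G = ⟨x_1,…,x_d⟩ = ⟨y_1,…,y_d⟩` with `d = d(G)`, for every `i` there exists `j`
such that replacing `x_i` by `y_j` still yields a generating set. -/
def MGSE (G : Type*) [Group G] : Prop :=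
  ∀ x y : Fin (minGen G) → G,
    Subgroup.closure (Set.range x) = ⊤ → Subgroup.closure (Set.range y) = ⊤ →
    ∀ i : Fin (minGen G), ∃ j : Fin (minGen G),
      Subgroup.closure (Set.range (Function.update x i (y j))) = ⊤

/-- Every generating set of a finite group contains a minimal generating set. -/
theorem exists_isMinimalGeneratingSet_subset {G : Type*} [Group G] [Finite G] {Z : Set G}
    (hZ : Subgroup.closure Z = ⊤) : ∃ S ⊆ Z, IsMinimalGeneratingSet S := by
  obtain ⟨S, hSZ, hS⟩ := exists_minimal_le_of_wellFoundedLT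
    (fun T : Set G => Subgroup.closure T = ⊤) Z hZ
  refine ⟨S, hSZ, hS.prop, fun s hs hgen => ?_⟩
  exact (hS.le_of_le hgen Set.sdiff_subset hs).2 rfl

/-- Every element outside the Frattini subgroup of a finite group lies in a minimal
generating set. -/
theorem exists_isMinimalGeneratingSet_mem {G : Type*} [Group G] [Finite G] {x : G}
    (hx : x ∉ frattini G) : ∃ S : Set G, IsMinimalGeneratingSet S ∧ x ∈ S := by
  obtain ⟨M, hM, hxM⟩ : ∃ M : Subgroup G, IsCoatom M ∧ x ∉ M := by
    by_contra! h
    refine hx ?_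
    simpa [frattini, Order.radical, Subgroup.mem_iInf] using h
  obtain ⟨S, hSM, hS⟩ := exists_isMinimalGeneratingSet_subset
    (Z := insert x (M : Set G)) (hM.2 _ (SetLike.lt_iff_le_and_exists.mpr
      ⟨fun m hm => Subgroup.subset_closure (Or.inr hm), x,
        Subgroup.subset_closure (Or.inl rfl), hxM⟩))
  refine ⟨S, hS, by_contra fun hxS => hM.1 (top_le_iff.mp ?_)⟩
  rw [← hS.1, Subgroup.closure_le]
  exact fun s hs => (hSM hs).resolve_left fun h => hxS (h ▸ hs)

/-- If every minimal generating set of a finite non-cyclic group lies in `C` or in its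
complement, then `C` and its complement cannot both generate the group. -/
theorem not_closure_eq_top_and_closure_compl_eq_top {G : Type*} [Group G] [Finite G]
    (hG : ¬ IsCyclic G) {C : Set G}
    (hC : ∀ S : Set G, IsMinimalGeneratingSet S → S ⊆ C ∨ S ⊆ Cᶜ) :
    ¬ (Subgroup.closure C = ⊤ ∧ Subgroup.closure Cᶜ = ⊤) := by
  rintro ⟨hgen, hgen'⟩
  have hsplit (A : Set G) (hA : Subgroup.closure A = ⊤) :
      Subgroup.closure (A ∩ C) = ⊤ ∨ Subgroup.closure (A ∩ Cᶜ) = ⊤ := by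
    obtain ⟨S, hSA, hS⟩ := exists_isMinimalGeneratingSet_subset hA
    refine (hC S hS).imp (fun h => ?_) (fun h => ?_) <;>
      exact top_le_iff.mp (hS.1 ▸ Subgroup.closure_mono (Set.subset_inter hSA h))
  have hsingle (g : G) : Subgroup.closure {g} ≠ ⊤ := fun h => hG
    ⟨g, fun a => Subgroup.mem_zpowers_iff.mp (by
      rw [Subgroup.zpowers_eq_closure, h]; trivial)⟩
  have : Nontrivial G := by
    by_contra h
    rw [not_nontrivial_iff_subsingleton] at h
    exact hG inferInstance
  obtain ⟨M, hM⟩ := IsCoatomic.exists_coatom (Subgroup G)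
  have hpart (D : Set G) (hD : D = C ∨ D = Cᶜ) (hDgen : Subgroup.closure Dᶜ = ⊤) :
      ¬ M ≤ Subgroup.closure (M ∩ D) := by
    intro hle
    obtain ⟨d, hdD, hdM⟩ : ∃ d ∈ Dᶜ, d ∉ M := by
      by_contra! h
      exact hM.1 (top_le_iff.mp (hDgen ▸ (Subgroup.closure_le M).mpr h))
    have htop : Subgroup.closure (insert d (M ∩ D)) = ⊤ :=
      hM.2 _ (SetLike.lt_iff_le_and_exists.mpr
        ⟨hle.trans (Subgroup.closure_mono (Set.subset_insert _ _)), d,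
          Subgroup.subset_closure (Or.inl rfl), hdM⟩)
    have hs : Subgroup.closure (insert d (M ∩ D) ∩ D) = ⊤ ∨
        Subgroup.closure (insert d (M ∩ D) ∩ Dᶜ) = ⊤ := by
      rcases hD with rfl | rfl
      · exact hsplit _ htop
      · rw [compl_compl]; exact (hsplit _ htop).symm
    rcases hs with h | h
    · refine hM.1 (top_le_iff.mp (h ▸ (Subgroup.closure_le M).mpr ?_))
      rintro a ⟨rfl | ha, haD⟩
      exacts [absurd haD hdD, ha.1]
    · refine hsingle d (top_le_iff.mp (h ▸ Subgroup.closure_mono ?_))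
      rintro a ⟨rfl | ha, haD⟩
      exacts [rfl, absurd ha.2 haD]
  have hcover : (M : Set G) ⊆ Subgroup.closure (M ∩ C) ∪ Subgroup.closure (M ∩ Cᶜ) :=
    fun m hm => (em (m ∈ C)).imp (fun h => Subgroup.subset_closure ⟨hm, h⟩)
      (fun h => Subgroup.subset_closure ⟨hm, h⟩)
  rcases SubgroupClass.subset_union.mp hcover with h | h
  · exact hpart C (Or.inl rfl) hgen' h
  · exact hpart Cᶜ (Or.inr rfl) (by rwa [compl_compl]) h

/-- The graph joining two distinct elements that lie in a common minimal generating set. -/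
def minimalGeneratingGraph (G : Type*) [Group G] : SimpleGraph G where
  Adj a b := a ≠ b ∧ ∃ S : Set G, IsMinimalGeneratingSet S ∧ a ∈ S ∧ b ∈ S
  symm := ⟨fun _ _ ⟨hne, S, hS, ha, hb⟩ => ⟨hne.symm, S, hS, hb, ha⟩⟩
  loopless := ⟨fun _ h => h.1 rfl⟩

theorem IsMinimalGeneratingSet.reachable {G : Type*} [Group G] {S : Set G}
    (hS : IsMinimalGeneratingSet S) {a b : G} (ha : a ∈ S) (hb : b ∈ S) :
    (minimalGeneratingGraph G).Reachable a b := by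
  by_cases hab : a = b
  · exact hab ▸ SimpleGraph.Reachable.refl a
  · exact SimpleGraph.Adj.reachable ⟨hab, S, hS, ha, hb⟩

theorem minimalGeneratingGraph_reachable {G : Type*} [Group G] [Finite G]
    (hG : ¬ IsCyclic G) {x y : G} (hx : x ∉ frattini G) (hy : y ∉ frattini G) :
    (minimalGeneratingGraph G).Reachable x y := by
  by_contra hxy
  obtain ⟨S, hS, hxS⟩ := exists_isMinimalGeneratingSet_mem hx
  obtain ⟨T, hT, hyT⟩ := exists_isMinimalGeneratingSet_mem hy
  refine not_closure_eq_top_and_closure_compl_eq_top hG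
    (C := {z | (minimalGeneratingGraph G).Reachable x z}) (fun U hU => ?_) ⟨?_, ?_⟩
  · by_cases h : ∃ u ∈ U, (minimalGeneratingGraph G).Reachable x u
    · obtain ⟨u, hu, hxu⟩ := h
      exact Or.inl fun v hv => hxu.trans (hU.reachable hu hv)
    · exact Or.inr fun u hu hxu => h ⟨u, hu, hxu⟩
  · exact top_le_iff.mp (hS.1 ▸ Subgroup.closure_mono fun s hs => hS.reachable hxS hs)
  · exact top_le_iff.mp (hT.1 ▸ Subgroup.closure_mono fun t ht hxt =>
      hxy (hxt.trans (hT.reachable ht hyT)))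

/-- For a finite non-cyclic group `G`, the hypergraph obtained from the global
generating hypergraph by removing its isolated vertices is connected. -/
theorem tildeDelta_connected {G : Type*} [Group G] [Finite G] (hG : ¬ IsCyclic G)
    (x y : G) (hx : x ∉ frattini G) (hy : y ∉ frattini G) :
    ∃ (k : ℕ) (z : Fin (k + 1) → G), z 0 = x ∧ z (Fin.last k) = y ∧
      Function.Injective z ∧
      ∀ i : Fin k, ∃ S : Set G, IsMinimalGeneratingSet S ∧
        z i.castSucc ∈ S ∧ z i.succ ∈ S := by
  obtain ⟨p, hp⟩ := (minimalGeneratingGraph_reachable hG hx hy).exists_isPath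
  refine ⟨p.length, fun i => p.getVert i, by simp, by simp, fun i j hij => ?_, fun i => ?_⟩
  · exact Fin.ext (hp.getVert_injOn (Nat.lt_succ_iff.mp i.2) (Nat.lt_succ_iff.mp j.2) hij)
  · exact (p.adj_getVert_succ i.2).2
end

section
/- Let G and X be finite groups and suppose there is a bijection f : X → G such that a subset S of X is a minimal generating set of X if and only if f(S) is a minimal generating set of G. Then a_n(X) = a_n(G) for every natural number n. -/
open Polynomial

/-- A subset of a finite group generates iff it contains a minimal generating set. -/
theorem closure_eq_top_iff_exists_isMinimalGeneratingSet
    {G : Type*} [Group G] [Finite G] (S : Set G) :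
    Subgroup.closure S = ⊤ ↔ ∃ T ⊆ S, IsMinimalGeneratingSet T := by
  constructor
  · intro hS
    obtain ⟨T, hTS, hT⟩ := exists_minimal_le_of_wellFoundedLT
      (fun T : Set G => Subgroup.closure T = ⊤) S hS
    refine ⟨T, hTS, hT.prop, fun s hs h => ?_⟩
    exact (hT.le_of_le h Set.sdiff_subset hs).2 rfl
  · rintro ⟨T, hTS, hT, -⟩
    exact top_le_iff.mp (hT ▸ Subgroup.closure_mono hTS)

open Classical in
/-- The generating function, in `T = 1 + t`, of the generating subsets of a finite group
is the sum of `μ(H) T ^ |H|` over all subgroups `H`. -/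
theorem sum_moebius_mul_X_pow_card {G : Type*} [Group G] [Fintype G]
    [Fintype (Subgroup G)] (μ : Subgroup G → ℤ) (hμ_top : μ ⊤ = 1)
    (hμ : ∀ H : Subgroup G, H ≠ ⊤ → μ H = -∑ᶠ K ∈ {K : Subgroup G | H < K}, μ K) :
    ∑ H : Subgroup G, C (μ H) * (X : ℤ[X]) ^ Nat.card H =
      ∑ S : Finset G, if Subgroup.closure (S : Set G) = ⊤ then (X - 1 : ℤ[X]) ^ S.card else 0 := by
  have sum_above (H : Subgroup G) : ∑ K with H ≤ K, μ K = if H = ⊤ then 1 else 0 := by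
    split_ifs with h
    · simp only [h, top_le_iff]
      rw [Finset.sum_filter, Fintype.sum_ite_eq', hμ_top]
    · have hlt : ∑ᶠ K ∈ {K : Subgroup G | H < K}, μ K = ∑ K with H < K, μ K := by
        rw [← finsum_mem_coe_finset]
        simp
      have hins : Finset.univ.filter (H ≤ ·) = insert H (Finset.univ.filter (H < ·)) := by
        ext K
        simp [le_iff_eq_or_lt, eq_comm]
      rw [hins, Finset.sum_insert (by simp), hμ H h, hlt, neg_add_cancel]
  have X_pow_card (H : Subgroup G) : (X : ℤ[X]) ^ Nat.card H =
      ∑ S : Finset G, if Subgroup.closure (S : Set G) ≤ H then (X - 1 : ℤ[X]) ^ S.card else 0 := by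
    have hpow := Finset.sum_pow_mul_eq_add_pow (X - 1 : ℤ[X]) 1 (Finset.univ.filter (· ∈ H))
    simp only [one_pow, mul_one, sub_add_cancel] at hpow
    rw [← Finset.sum_filter, Nat.card_eq_fintype_card, Fintype.card_subtype, ← hpow]
    refine Finset.sum_congr ?_ fun _ _ => rfl
    ext S
    simp [Finset.subset_iff, Set.subset_def]
  simp_rw [X_pow_card, Finset.mul_sum]
  rw [Finset.sum_comm]
  refine Finset.sum_congr rfl fun S _ => ?_
  simp_rw [mul_ite, mul_zero]
  rw [← Finset.sum_filter, ← Finset.sum_mul, ← map_sum, sum_above]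
  split_ifs <;> simp

/-- Since `|H| [G : H] = |G|`, summing over the subgroups of index `n` amounts to extracting
a coefficient of the polynomial `∑ μ(H) T ^ |H|`. -/
theorem finsum_mem_index_eq_coeff {G : Type*} [Group G] [Finite G] [Fintype (Subgroup G)]
    (μ : Subgroup G → ℤ) {m n : ℕ} (h : m * n = Nat.card G) :
    ∑ᶠ H ∈ {H : Subgroup G | H.index = n}, μ H =
      (∑ H : Subgroup G, C (μ H) * (X : ℤ[X]) ^ Nat.card H).coeff m := by
  classical
  have index_eq_iff (H : Subgroup G) : H.index = n ↔ m = Nat.card H := by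
    have hH := H.card_mul_index.trans h.symm
    have hpos : 0 < m * n := h ▸ Nat.card_pos
    constructor
    · rintro rfl
      exact (Nat.eq_of_mul_eq_mul_right (Nat.pos_of_mul_pos_left hpos) hH).symm
    · rintro rfl
      exact Nat.eq_of_mul_eq_mul_left (Nat.pos_of_mul_pos_right hpos) hH
  simp_rw [finsetSum_coeff, coeff_C_mul_X_pow, ← index_eq_iff]
  rw [← Finset.sum_filter, ← finsum_mem_coe_finset]
  simp

/-- If a bijection between two finite groups preserves minimal generating sets in both
directions, then the Möbius-function sums `a_n` agree for every `n`. Here the Möbius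
functions `μX`, `μG` on the subgroup lattices are characterised by their defining
recurrences `μ(⊤) = 1` and `μ(H) = -∑_{H < K} μ(K)` for `H ≠ ⊤`, and
`a_n(G) = ∑_{H of index n} μ_G(H)`. -/
theorem an_eq_of_minimalGeneratingSet_equiv
    {X G : Type*} [Group X] [Group G] [Finite X] [Finite G] (f : X ≃ G)
    (hf : ∀ S : Set X, IsMinimalGeneratingSet S ↔ IsMinimalGeneratingSet (f '' S))
    (μX : Subgroup X → ℤ) (μG : Subgroup G → ℤ)
    (hμX_top : μX ⊤ = 1)
    (hμX : ∀ H : Subgroup X, H ≠ ⊤ → μX H = -∑ᶠ K ∈ {K : Subgroup X | H < K}, μX K)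
    (hμG_top : μG ⊤ = 1)
    (hμG : ∀ H : Subgroup G, H ≠ ⊤ → μG H = -∑ᶠ K ∈ {K : Subgroup G | H < K}, μG K) :
    ∀ n : ℕ, ∑ᶠ H ∈ {H : Subgroup X | H.index = n}, μX H
      = ∑ᶠ H ∈ {H : Subgroup G | H.index = n}, μG H := by
  classical
  have := Fintype.ofFinite X
  have := Fintype.ofFinite G
  have := Fintype.ofFinite (Subgroup X)
  have := Fintype.ofFinite (Subgroup G)
  have generates_iff (S : Set X) :
      Subgroup.closure S = ⊤ ↔ Subgroup.closure (f '' S) = ⊤ := by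
    rw [closure_eq_top_iff_exists_isMinimalGeneratingSet,
      closure_eq_top_iff_exists_isMinimalGeneratingSet, Set.exists_subset_image_iff]
    simp only [hf]
  have sum_eq : ∑ H : Subgroup X, C (μX H) * (Polynomial.X : ℤ[X]) ^ Nat.card H =
      ∑ H : Subgroup G, C (μG H) * (Polynomial.X : ℤ[X]) ^ Nat.card H := by
    rw [sum_moebius_mul_X_pow_card μX hμX_top hμX, sum_moebius_mul_X_pow_card μG hμG_top hμG]
    refine Fintype.sum_equiv f.finsetCongr _ _ fun S => ?_
    simp [generates_iff]
  intro n
  by_cases hn : ∃ m, m * n = Nat.card X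
  · obtain ⟨m, hm⟩ := hn
    rw [finsum_mem_index_eq_coeff μX hm,
      finsum_mem_index_eq_coeff μG (hm.trans (Nat.card_congr f)), sum_eq]
  · have hX : {H : Subgroup X | H.index = n} = ∅ :=
      Set.eq_empty_of_forall_notMem fun H hH => hn ⟨Nat.card H, hH ▸ H.card_mul_index⟩
    have hG : {H : Subgroup G | H.index = n} = ∅ :=
      Set.eq_empty_of_forall_notMem fun H hH =>
        hn ⟨Nat.card H, (hH ▸ H.card_mul_index).trans (Nat.card_congr f).symm⟩
    rw [hX, hG, finsum_mem_empty, finsum_mem_empty]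
end

section
/- Let G and X be finite groups and suppose there is a bijection f : X → G such that a subset S of X is a minimal generating set of X if and only if f(S) is a minimal generating set of G. If G is solvable, then X is solvable. -/
open Subgroup

section Generation

variable {X G : Type*} [Group X] [Group G]

/-- In a finite group every generating set contains a minimal one. -/
lemma exists_subset_isMinimalGeneratingSet [Finite X] {S : Set X} (hS : closure S = ⊤) :
    ∃ T ⊆ S, IsMinimalGeneratingSet T := by
  obtain ⟨T, hTS, hT⟩ := exists_minimal_le_of_wellFoundedLT
    (fun T : Set X ↦ closure T = ⊤) S hS
  refine ⟨T, hTS, hT.prop, fun s hs h ↦ ?_⟩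
  exact (hT.le_of_le h Set.sdiff_subset hs).2 rfl

lemma closure_image_eq_top_iff [Finite X] [Finite G] (f : X ≃ G)
    (hf : ∀ S : Set X, IsMinimalGeneratingSet S ↔ IsMinimalGeneratingSet (f '' S)) (S : Set X) :
    closure (f '' S) = ⊤ ↔ closure S = ⊤ := by
  constructor <;> intro h
  · obtain ⟨T, hTS, hT⟩ := exists_subset_isMinimalGeneratingSet h
    rw [← f.image_symm_image T, ← hf] at hT
    refine top_unique (hT.1.ge.trans (closure_mono ?_))
    rintro _ ⟨t, ht, rfl⟩
    obtain ⟨s, hs, rfl⟩ := hTS ht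
    simpa using hs
  · obtain ⟨T, hTS, hT⟩ := exists_subset_isMinimalGeneratingSet h
    exact top_unique (((hf T).1 hT).1.ge.trans (closure_mono (Set.image_mono hTS)))

/-- A bijection preserving generating sets maps maximal subgroups, which are the maximal
non-generating sets, to maximal subgroups. -/
lemma exists_isCoatom_coe_eq_image (f : X ≃ G)
    (hf : ∀ S : Set X, closure (f '' S) = ⊤ ↔ closure S = ⊤) {M : Subgroup X} (hM : IsCoatom M) :
    ∃ L : Subgroup G, IsCoatom L ∧ (L : Set G) = f '' M := by
  have hpre (L : Subgroup G) : closure (f ⁻¹' L) = ⊤ ↔ L = ⊤ := by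
    rw [← hf, f.image_preimage, closure_eq]
  have hML : (M : Set X) ⊆ f ⁻¹' closure (f '' M) := Set.image_subset_iff.1 subset_closure
  have key (L : Subgroup G) (hL : (M : Set X) ⊆ f ⁻¹' L) (htop : L ≠ ⊤) :
      f ⁻¹' L ⊆ (M : Set X) := by
    have h := hM.le_iff.1 (show M ≤ closure (f ⁻¹' L) from hL.trans subset_closure)
    rw [hpre, or_iff_right htop] at h
    exact subset_closure.trans h.le
  have hne : closure (f '' M) ≠ ⊤ := by rw [Ne, hf, closure_eq]; exact hM.1
  have himage : (closure (f '' M) : Set G) = f '' M := by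
    refine Set.Subset.antisymm ?_ subset_closure
    rw [← f.image_preimage (closure (f '' M) : Set G)]
    exact Set.image_mono (key _ hML hne)
  refine ⟨closure (f '' M), ⟨hne, fun L hL ↦ ?_⟩, himage⟩
  by_contra htop
  refine hL.not_ge fun g hg ↦ ?_
  obtain ⟨x, rfl⟩ := f.surjective g
  exact subset_closure ⟨x, key L (hML.trans fun x hx ↦ hL.le hx) htop hg, rfl⟩

end Generation

section Factorisation

variable {G : Type*} [Group G]

/-- For subgroups of a finite group, `|N : M ∩ N| = |G : M|` if and only if `G = N M`. -/
lemma relIndex_eq_index_iff [Finite G] (M N : Subgroup G) :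
    M.relIndex N = M.index ↔ ∀ g, ∃ n ∈ N, n⁻¹ * g ∈ M := by
  have hstab : MulAction.stabilizer N ((1 : G) : G ⧸ M) = M.subgroupOf N := by
    ext n
    rw [MulAction.mem_stabilizer_iff, mem_subgroupOf, eq_comm]
    change ((1 : G) : G ⧸ M) = (((n : G) * 1 : G) : G ⧸ M) ↔ _
    rw [QuotientGroup.eq]
    simp
  have horbit : MulAction.orbit N ((1 : G) : G ⧸ M) = Set.univ ↔
      ∀ g, ∃ n ∈ N, n⁻¹ * g ∈ M := by
    rw [Set.eq_univ_iff_forall, QuotientGroup.forall_mk]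
    refine forall_congr' fun g ↦ ?_
    constructor
    · rintro ⟨n, hn⟩
      refine ⟨n, n.2, ?_⟩
      replace hn : (((n : G) * 1 : G) : G ⧸ M) = (g : G ⧸ M) := hn
      simpa using QuotientGroup.eq.1 hn
    · rintro ⟨n, hn, h⟩
      refine ⟨⟨n, hn⟩, ?_⟩
      change ((n * 1 : G) : G ⧸ M) = (g : G ⧸ M)
      exact QuotientGroup.eq.2 (by simpa using h)
  rw [← horbit, relIndex, ← hstab, MulAction.index_stabilizer, index_eq_card, ← Set.ncard_univ]
  exact ⟨fun h ↦ Set.eq_of_subset_of_ncard_le (Set.subset_univ _) h.ge, fun h ↦ by rw [h]⟩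

lemma relIndex_eq_index_of_sup_eq_top [Finite G] {A M N : Subgroup G} [A.Normal] (hAM : A ≤ M)
    (h : A ⊔ N = ⊤) : M.relIndex N = M.index := by
  rw [relIndex_eq_index_iff]
  intro g
  obtain ⟨n, hn, a, ha, rfl⟩ := mem_sup_of_normal_right.1 (sup_comm A N ▸ h ▸ mem_top g)
  exact ⟨n, hn, by simpa using hAM ha⟩

lemma relIndex_normal_eq_index [Finite G] {M N : Subgroup G} [N.Normal] (h : N ⊔ M = ⊤) :
    M.relIndex N = M.index := by
  rw [relIndex_eq_index_iff]
  intro g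
  obtain ⟨n, hn, a, ha, rfl⟩ := mem_sup_of_normal_left.1 (h ▸ mem_top g)
  exact ⟨n, hn, by simpa using ha⟩

/-- A finite group is not the product of two conjugate proper subgroups. -/
lemma relIndex_map_conj_ne_index [Finite G] {M : Subgroup G} (hM : M ≠ ⊤) (x : G) :
    M.relIndex (M.map (MulAut.conj x).toMonoidHom) ≠ M.index := by
  rw [Ne, relIndex_eq_index_iff]
  intro h
  have hx : x ∈ M := by
    obtain ⟨_, ⟨m, hm, rfl⟩, h⟩ := h x
    have hxm : x * m⁻¹ ∈ M := by simpa [mul_assoc] using h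
    simpa using M.mul_mem hxm hm
  refine hM ((eq_top_iff' M).2 fun g ↦ ?_)
  obtain ⟨_, ⟨m, hm, rfl⟩, h⟩ := h g
  have hc : x * m * x⁻¹ ∈ M := M.mul_mem (M.mul_mem hx hm) (M.inv_mem hx)
  rw [← mul_inv_cancel_left (x * m * x⁻¹) g]
  exact M.mul_mem hc h

end Factorisation

section Solvable

variable {G : Type*} [Group G] [Finite G]

lemma exists_normal_isPGroup_ne_bot [Nontrivial G] [Group.IsSolvable G] :
    ∃ p : ℕ, p.Prime ∧ ∃ V : Subgroup G, V.Normal ∧ V ≠ ⊥ ∧ IsPGroup p V := by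
  obtain ⟨D, hD, hne, hcomm⟩ : ∃ D : Subgroup G, D.Normal ∧ D ≠ ⊥ ∧ ⁅D, D⁆ = ⊥ := by
    have hex := ‹Group.IsSolvable G›.solvable
    classical
    have h0 : Nat.find hex ≠ 0 := fun h ↦ by
      have := Nat.find_spec hex
      rw [h, derivedSeries_zero] at this
      exact top_ne_bot this
    obtain ⟨n, hn⟩ := Nat.exists_eq_succ_of_ne_zero h0
    refine ⟨derivedSeries G n, derivedSeries_normal G n, Nat.find_min hex (by omega), ?_⟩
    rw [← derivedSeries_succ, ← Nat.succ_eq_add_one, ← hn]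
    exact Nat.find_spec hex
  have hDcomm (a b : D) : a * b = b * a := by
    have := commutator_eq_bot_iff_le_centralizer.1 hcomm
    exact Subtype.ext (mem_centralizer_iff.1 (this b.2) a a.2)
  have : Nontrivial D := (nontrivial_iff_ne_bot D).2 hne
  obtain ⟨p, hp, hpD⟩ := Nat.exists_prime_and_dvd (Finite.one_lt_card (α := D)).ne'
  have : Fact p.Prime := ⟨hp⟩
  let P : Sylow p D := default
  have hPn : (P : Subgroup D).Normal :=
    ⟨fun n hn g ↦ by rwa [hDcomm g n, mul_inv_cancel_right]⟩
  have : (P : Subgroup D).Characteristic := P.characteristic_of_normal hPn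
  refine ⟨p, hp, (P : Subgroup D).map D.subtype, inferInstance, ?_, P.isPGroup'.map _⟩
  rw [Ne, map_eq_bot_iff_of_injective _ D.subtype_injective]
  exact P.ne_bot_of_dvd_card hpD

/-- The maximal subgroups of a finite solvable group with a given normal core all have index a
power of the same prime. -/
lemma exists_prime_forall_index_eq_pow [Group.IsSolvable G] {A : Subgroup G} [A.Normal]
    (hA : A ≠ ⊤) :
    ∃ p : ℕ, p.Prime ∧
      ∀ M : Subgroup G, IsCoatom M → M.normalCore = A → ∃ n, M.index = p ^ n := by
  have : Nontrivial (G ⧸ A) := QuotientGroup.nontrivial_iff.2 hA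
  obtain ⟨p, hp, V, hV, hne, hVp⟩ := exists_normal_isPGroup_ne_bot (G := G ⧸ A)
  have : Fact p.Prime := ⟨hp⟩
  refine ⟨p, hp, fun M hM hMA ↦ ?_⟩
  let π := QuotientGroup.mk' A
  have hAM : A ≤ M := hMA ▸ M.normalCore_le
  have hVM : ¬ V.comap π ≤ M := fun h ↦ by
    rw [← normal_le_normalCore, hMA] at h
    refine hne ((eq_bot_iff_forall V).2 fun x hx ↦ ?_)
    obtain ⟨g, rfl⟩ := QuotientGroup.mk'_surjective A x
    exact (QuotientGroup.eq_one_iff g).2 (h hx)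
  have hsup : V.comap π ⊔ M = ⊤ := by
    rw [sup_comm]
    exact hM.2 _ (left_lt_sup.2 hVM)
  rw [← relIndex_normal_eq_index hsup]
  obtain ⟨n, hn⟩ := IsPGroup.iff_card.1 hVp
  have hdvd : M.relIndex (V.comap π) ∣ p ^ n := by
    refine (relIndex_dvd_of_le_left _ hAM).trans ?_
    have hker := relIndex_ker (K := V.comap π) π
    rw [QuotientGroup.ker_mk', map_comap_eq_self_of_surjective (QuotientGroup.mk'_surjective A),
      hn] at hker
    exact hker.dvd
  obtain ⟨m, -, hm⟩ := (Nat.dvd_prime_pow hp).1 hdvd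
  exact ⟨m, hm⟩

/-- If all maximal subgroups not containing the normal subgroup `K` have index a power of the
prime `p`, then `K` is solvable. -/
lemma isSolvable_of_forall_index_eq_pow {K : Subgroup G} [K.Normal] {p : ℕ} (hp : p.Prime)
    (h : ∀ M : Subgroup G, IsCoatom M → ¬ K ≤ M → ∃ n, M.index = p ^ n) :
    Group.IsSolvable K := by
  have : Fact p.Prime := ⟨hp⟩
  let P : Sylow p K := default
  let Q : Subgroup G := (P : Subgroup K).map K.subtype
  have key (M : Subgroup G) (hM : IsCoatom M) (hQM : Q ≤ M) : K ≤ M := by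
    by_contra hKM
    obtain ⟨n, hn⟩ := h M hM hKM
    have hsup : K ⊔ M = ⊤ := by
      rw [sup_comm]
      exact hM.2 _ (left_lt_sup.2 hKM)
    have hdvd : p ^ n ∣ (P : Subgroup K).index := by
      rw [← hn, ← relIndex_normal_eq_index hsup]
      exact index_dvd_of_le (map_le_iff_le_comap.1 hQM)
    rcases n.eq_zero_or_pos with rfl | hpos
    · exact hM.1 (index_eq_one.1 (by simpa using hn))
    · exact P.not_dvd_index ((dvd_pow_self p hpos.ne').trans hdvd)
  have hQ : Q.Normal := by
    rw [← normalizer_eq_top_iff]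
    by_contra hne
    obtain ⟨M, hM, hle⟩ := (eq_top_or_exists_le_coatom (normalizer (Q : Set G))).resolve_left hne
    refine hM.1 (top_unique ?_)
    rw [← P.normalizer_sup_eq_top]
    exact sup_le hle (key M hM (le_normalizer.trans hle))
  let π := QuotientGroup.mk' Q
  have hfrat (k : K) : π k ∈ frattini (G ⧸ Q) := by
    rw [frattini, Order.radical]
    simp only [mem_iInf]
    intro M hM
    refine key _ (isCoatom_comap_of_surjective (QuotientGroup.mk'_surjective Q) hM) ?_ k.2
    exact (QuotientGroup.ker_mk' Q).ge.trans (M.ker_le_comap π)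
  have := frattini_nilpotent (G := G ⧸ Q)
  have := P.isPGroup'.isNilpotent
  refine Group.isSolvable_of_ker_le_range (P : Subgroup K).subtype
    ((π.comp K.subtype).codRestrict (frattini (G ⧸ Q)) hfrat) fun k hk ↦ ?_
  rw [range_subtype]
  have hk1 : π k = 1 := congrArg Subtype.val (MonoidHom.mem_ker.1 hk)
  obtain ⟨y, hy, hyk⟩ : (k : G) ∈ Q := (QuotientGroup.eq_one_iff _).1 hk1
  rwa [← Subtype.ext hyk]

/-- A finite group without nontrivial perfect normal subgroups is solvable. -/
lemma isSolvable_of_forall_normal_perfect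
    (h : ∀ K : Subgroup G, K.Normal → ⁅K, K⁆ = K → K = ⊥) : Group.IsSolvable G := by
  obtain ⟨n, hn⟩ := WellFoundedLT.antitone_chain_condition (derivedSeries_antitone G)
  exact ⟨n, h _ (derivedSeries_normal G n) (hn (n + 1) n.le_succ).symm⟩

end Solvable

/-- A solvable perfect subgroup is trivial. -/
lemma eq_bot_of_perfect_of_isSolvable {G : Type*} [Group G] {K : Subgroup G} (hK : ⁅K, K⁆ = K) [Group.IsSolvable K] :
    K = ⊥ := by
  by_contra hne
  have : Nontrivial K := (nontrivial_iff_ne_bot K).2 hne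
  refine (Group.IsSolvable.commutator_lt_top_of_nontrivial K).ne ?_
  apply map_injective K.subtype_injective
  rw [_root_.commutator_def, map_commutator, ← MonoidHom.range_eq_map, range_subtype, hK]

/-- If a bijection between two finite groups preserves minimal generating sets in both
directions and `G` is solvable, then `X` is solvable. -/
theorem solvable_of_minimalGeneratingSet_equiv
    {X G : Type*} [Group X] [Group G] [Finite X] [Finite G] (f : X ≃ G)
    (hf : ∀ S : Set X, IsMinimalGeneratingSet S ↔ IsMinimalGeneratingSet (f '' S))
    (hG : IsSolvable G) : IsSolvable X := by
  have : Group.IsSolvable G := hG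
  choose! φ hφ hφf using fun (M : Subgroup X) (hM : IsCoatom M) ↦
    exists_isCoatom_coe_eq_image f (closure_image_eq_top_iff f hf) hM
  have hmem {M : Subgroup X} (hM : IsCoatom M) (x : X) : f x ∈ φ M ↔ x ∈ M := by
    rw [← SetLike.mem_coe, hφf M hM, f.injective.mem_set_image, SetLike.mem_coe]
  have hcardX : Nat.card X = Nat.card G := Nat.card_congr f
  have hcard {M : Subgroup X} (hM : IsCoatom M) : Nat.card M = Nat.card (φ M) :=
    Nat.card_congr (f.subtypeEquiv fun x ↦ (hmem hM x).symm)
  have hindex {M : Subgroup X} (hM : IsCoatom M) : M.index = (φ M).index := by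
    have h := M.card_mul_index
    rw [hcardX, ← (φ M).card_mul_index, hcard hM] at h
    exact Nat.eq_of_mul_eq_mul_left Nat.card_pos h
  have hrelIndex {M N : Subgroup X} (hM : IsCoatom M) (hN : IsCoatom N) :
      M.relIndex N = (φ M).relIndex (φ N) := by
    have hinf : Nat.card (M ⊓ N : Subgroup X) = Nat.card (φ M ⊓ φ N : Subgroup G) :=
      Nat.card_congr (f.subtypeEquiv fun x ↦ by simp only [mem_inf, hmem hM, hmem hN])
    have h₁ := relIndex_mul_relIndex ⊥ (M ⊓ N) N bot_le inf_le_right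
    have h₂ := relIndex_mul_relIndex ⊥ (φ M ⊓ φ N) (φ N) bot_le inf_le_right
    simp only [relIndex_bot_left, inf_relIndex_right] at h₁ h₂
    rw [hcard hN, ← h₂, hinf] at h₁
    exact Nat.eq_of_mul_eq_mul_left Nat.card_pos h₁
  refine isSolvable_of_forall_normal_perfect fun K _ hperf ↦ ?_
  by_cases hall : ∀ M : Subgroup X, IsCoatom M → K ≤ M
  · have hle : K ≤ frattini X := le_iInf₂ hall
    have := frattini_nilpotent (G := X)
    have : Group.IsSolvable K := Group.isSolvable_of_isSolvable_injective (inclusion_injective hle)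
    exact eq_bot_of_perfect_of_isSolvable hperf
  push Not at hall
  obtain ⟨M, ⟨hM, hKM⟩, hmax⟩ := Set.exists_max_image
    {M : Subgroup X | IsCoatom M ∧ ¬ K ≤ M} (fun M ↦ Nat.card (φ M).normalCore)
    (Set.toFinite _) hall
  obtain ⟨p, hp, hindexp⟩ := exists_prime_forall_index_eq_pow (A := (φ M).normalCore)
    (ne_top_of_le_ne_top (hφ M hM).1 (φ M).normalCore_le)
  -- the core of `φ M` lies in the image of the core of `M`
  have hcore {x : X} (hx : f x ∈ (φ M).normalCore) : x ∈ M.normalCore := by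
    intro y
    have hconj : IsCoatom (M.map (MulAut.conj y⁻¹).toMonoidHom) :=
      (OrderIso.isCoatom_iff (MulEquiv.mapSubgroup (MulAut.conj y⁻¹)) M).2 hM
    have hle : (φ M).normalCore ≤ φ (M.map (MulAut.conj y⁻¹).toMonoidHom) := by
      by_contra hnot
      refine relIndex_map_conj_ne_index hM.1 y⁻¹ ?_
      rw [hrelIndex hM hconj, hindex hM]
      refine relIndex_eq_index_of_sup_eq_top (φ M).normalCore_le ?_
      rw [sup_comm]
      exact (hφ _ hconj).2 _ (left_lt_sup.2 hnot)
    obtain ⟨m, hm, hmx⟩ := (hmem hconj x).1 (hle hx)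
    have : y * x * y⁻¹ = m := by
      rw [← hmx]
      simp [mul_assoc]
    rwa [this]
  let π := QuotientGroup.mk' M.normalCore
  have hπ : Function.Surjective π := QuotientGroup.mk'_surjective _
  have : (K.map π).Normal := Normal.map ‹_› π hπ
  have : Group.IsSolvable (K.map π) := by
    refine isSolvable_of_forall_index_eq_pow hp fun L hL hKL ↦ ?_
    have hL' := isCoatom_comap_of_surjective hπ hL
    rw [map_le_iff_le_comap] at hKL
    rw [← index_comap_of_surjective L hπ, hindex hL']
    refine hindexp _ (hφ _ hL') ?_
    have hle : (φ M).normalCore ≤ (φ (L.comap π)).normalCore := by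
      rw [normal_le_normalCore]
      intro g hg
      obtain ⟨x, rfl⟩ := f.surjective g
      rw [hmem hL']
      exact L.ker_le_comap π ((QuotientGroup.ker_mk' M.normalCore).ge (hcore hg))
    exact (eq_of_le_of_card_ge hle (hmax _ ⟨hL', hKL⟩)).symm
  have hbot : K.map π = ⊥ :=
    eq_bot_of_perfect_of_isSolvable (by rw [← map_commutator, hperf])
  rw [Subgroup.map_eq_bot_iff, QuotientGroup.ker_mk'] at hbot
  exact absurd (hbot.trans M.normalCore_le) hKM
end

section
/- Let G be a finite group. Then G satisfies the MGSE property if and only if the quotient group G/Frat(G) satisfies the MGSE property. -/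
/-- A subset of a finite group generates it if and only if its image generates the
Frattini quotient. -/
theorem closure_image_mk_frattini_eq_top_iff {G : Type*} [Group G] [Finite G] (S : Set G) :
    Subgroup.closure (QuotientGroup.mk '' S : Set (G ⧸ frattini G)) = ⊤ ↔
      Subgroup.closure S = ⊤ := by
  have hmap := MonoidHom.map_closure (QuotientGroup.mk' (frattini G)) S
  rw [QuotientGroup.coe_mk'] at hmap
  rw [← hmap]
  constructor
  · intro h
    apply frattini_nongenerating
    rw [← QuotientGroup.ker_mk' (frattini G), ← Subgroup.comap_map_eq, h, Subgroup.comap_top]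
  · intro h
    rw [h, Subgroup.map_top_of_surjective _ (QuotientGroup.mk'_surjective _)]

theorem closure_range_mk_frattini_eq_top_iff {G ι : Type*} [Group G] [Finite G] (x : ι → G) :
    Subgroup.closure (Set.range fun i => (x i : G ⧸ frattini G)) = ⊤ ↔
      Subgroup.closure (Set.range x) = ⊤ := by
  rw [← closure_image_mk_frattini_eq_top_iff (Set.range x), ← Set.range_comp]
  rfl

theorem minGen_le_card {G : Type*} [Group G] {S : Finset G}
    (hS : Subgroup.closure (S : Set G) = ⊤) : minGen G ≤ S.card :=
  Nat.sInf_le ⟨S, rfl, hS⟩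

theorem exists_card_eq_minGen (G : Type*) [Group G] [Finite G] :
    ∃ S : Finset G, S.card = minGen G ∧ Subgroup.closure (S : Set G) = ⊤ := by
  have := Fintype.ofFinite G
  exact Nat.sInf_mem (s := {n | ∃ S : Finset G, S.card = n ∧ Subgroup.closure (S : Set G) = ⊤})
    ⟨_, Finset.univ, rfl, by simp⟩

theorem minGen_quotient_frattini (G : Type*) [Group G] [Finite G] :
    minGen (G ⧸ frattini G) = minGen G := by
  classical
  apply le_antisymm
  · obtain ⟨S, hcard, hS⟩ := exists_card_eq_minGen G
    rw [← hcard]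
    refine (minGen_le_card (S := S.image QuotientGroup.mk) ?_).trans Finset.card_image_le
    rwa [Finset.coe_image, closure_image_mk_frattini_eq_top_iff]
  · obtain ⟨T, hcard, hT⟩ := exists_card_eq_minGen (G ⧸ frattini G)
    rw [← hcard]
    refine (minGen_le_card (S := T.image Quotient.out) ?_).trans Finset.card_image_le
    rw [← closure_image_mk_frattini_eq_top_iff, Finset.coe_image, Set.image_image]
    simpa using hT

/-- A finite group satisfies the MGSE property if and only if its Frattini
quotient does. -/
theorem mgse_iff_quotient_frattini {G : Type*} [Group G] [Finite G] :
    MGSE G ↔ MGSE (G ⧸ frattini G) := by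
  unfold MGSE
  rw [minGen_quotient_frattini]
  have hupdate (x : Fin (minGen G) → G) (i : Fin (minGen G)) (g : G) :
      Subgroup.closure (Set.range
        (Function.update (fun k => (x k : G ⧸ frattini G)) i (g : G ⧸ frattini G))) = ⊤ ↔
        Subgroup.closure (Set.range (Function.update x i g)) = ⊤ := by
    rw [← closure_range_mk_frattini_eq_top_iff (Function.update x i g)]
    exact iff_of_eq (congrArg (fun z => Subgroup.closure (Set.range z) = ⊤)
      (Function.comp_update QuotientGroup.mk x i g).symm)
  constructor
  · intro h x y hx hy i
    obtain ⟨x, rfl⟩ := QuotientGroup.mk_surjective.comp_left x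
    obtain ⟨y, rfl⟩ := QuotientGroup.mk_surjective.comp_left y
    obtain ⟨j, hj⟩ := h x y ((closure_range_mk_frattini_eq_top_iff x).mp hx)
      ((closure_range_mk_frattini_eq_top_iff y).mp hy) i
    exact ⟨j, (hupdate x i (y j)).mpr hj⟩
  · intro h x y hx hy i
    obtain ⟨j, hj⟩ := h _ _ ((closure_range_mk_frattini_eq_top_iff x).mpr hx)
      ((closure_range_mk_frattini_eq_top_iff y).mpr hy) i
    exact ⟨j, (hupdate x i (y j)).mp hj⟩
end

section
/- Let G be a finite group satisfying the MGSE property. Then for every normal subgroup N of G, the quotient group G/N satisfies the MGSE property. -/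
open Subgroup

section Gaschutz

variable {G Q ι : Type*} [Group G] [Group Q]

theorem map_closure_range (π : G →* Q) (s : ι → G) :
    (closure (Set.range s)).map π = closure (Set.range (π ∘ s)) := by
  rw [MonoidHom.map_closure, Set.range_comp]

open Classical in
/-- The number of lifts of a tuple along `π` with entries in a subgroup `H` mapping onto the
target is at most the same number for any other tuple. -/
theorem card_lifts_in_le [Fintype (ι → G)] (π : G →* Q) {H : Subgroup G} (hH : H.map π = ⊤)
    (t t' : ι → Q) :
    (Finset.univ.filter fun s : ι → G => π ∘ s = t ∧ closure (Set.range s) ≤ H).card ≤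
      (Finset.univ.filter fun s : ι → G => π ∘ s = t' ∧ closure (Set.range s) ≤ H).card := by
  have hlift (i : ι) : ∃ a ∈ H, π a = t' i * (t i)⁻¹ :=
    mem_map.mp (hH ▸ mem_top (t' i * (t i)⁻¹))
  choose a haH ha using hlift
  refine Finset.card_le_card_of_injOn (fun s => a * s) ?_ (mul_right_injective a).injOn
  intro s hs
  simp only [Finset.coe_filter, Finset.mem_univ, true_and, Set.mem_ofPred_eq, closure_le,
    Set.range_subset_iff] at hs ⊢
  obtain ⟨rfl, hsH⟩ := hs
  exact ⟨funext fun i => by simp [ha], fun i => H.mul_mem (haH i) (hsH i)⟩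

open Classical in
/-- The number of lifts of a generating tuple of `Q` that generate a given subgroup `H` of `G`
does not depend on the tuple. -/
theorem card_lifts_generating_eq [Finite G] [Fintype (ι → G)] (π : G →* Q) {t t' : ι → Q}
    (ht : closure (Set.range t) = ⊤) (ht' : closure (Set.range t') = ⊤) (H : Subgroup G) :
    (Finset.univ.filter fun s : ι → G => π ∘ s = t ∧ closure (Set.range s) = H).card =
      (Finset.univ.filter fun s : ι → G => π ∘ s = t' ∧ closure (Set.range s) = H).card := by
  induction H using WellFoundedLT.induction with
  | ind H ih =>
  by_cases hH : H.map π = ⊤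
  · have : Fintype (Subgroup G) := Fintype.ofFinite _
    have hsum (u : ι → Q) :
        (Finset.univ.filter fun s : ι → G => π ∘ s = u ∧ closure (Set.range s) ≤ H).card =
          (Finset.univ.filter fun s : ι → G => π ∘ s = u ∧ closure (Set.range s) = H).card +
          ∑ K ∈ Finset.univ.filter (· < H),
            (Finset.univ.filter fun s : ι → G => π ∘ s = u ∧ closure (Set.range s) = K).card := by
      rw [← Finset.sum_insert (s := Finset.univ.filter (· < H)) (a := H) (f := fun K =>
        (Finset.univ.filter fun s : ι → G => π ∘ s = u ∧ closure (Set.range s) = K).card)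
        (by simp)]
      rw [Finset.card_eq_sum_card_fiberwise (f := fun s : ι → G => closure (Set.range s))
        (t := insert H (Finset.univ.filter (· < H)))]
      · refine Finset.sum_congr rfl fun K hK => ?_
        have hKH : K ≤ H := by
          simpa [← le_iff_eq_or_lt] using hK
        congr 1
        ext s
        simp only [Finset.mem_filter, Finset.mem_univ, true_and]
        exact ⟨fun h => ⟨h.1.1, h.2⟩, fun h => ⟨⟨h.1, h.2.trans_le hKH⟩, h.2⟩⟩
      · intro s hs
        have hs' : closure (Set.range s) ≤ H := (Finset.mem_filter.mp hs).2.2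
        simpa [-closure_le] using hs'.eq_or_lt
    have htotal := (card_lifts_in_le π hH t t').antisymm (card_lifts_in_le π hH t' t)
    rw [hsum, hsum, Finset.sum_congr rfl fun K hK => ih K (Finset.mem_filter.mp hK).2] at htotal
    exact Nat.add_right_cancel htotal
  · have hempty {u : ι → Q} (hu : closure (Set.range u) = ⊤) :
        (Finset.univ.filter fun s : ι → G => π ∘ s = u ∧ closure (Set.range s) = H) = ∅ := by
      refine Finset.filter_eq_empty_iff.mpr fun s _ hs => hH ?_
      rw [← hs.2, map_closure_range, hs.1, hu]
    exact congrArg Finset.card ((hempty ht).trans (hempty ht').symm)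

/-- **Gaschütz's lemma**: if `G` is finite and generated by some tuple indexed by `ι`, then every
generating tuple of a quotient of `G` indexed by `ι` lifts to a generating tuple of `G`. -/
theorem exists_generating_lift [Finite G] [Finite ι] (π : G →* Q)
    (hπ : Function.Surjective π) {s₀ : ι → G} (hs₀ : closure (Set.range s₀) = ⊤)
    {t : ι → Q} (ht : closure (Set.range t) = ⊤) :
    ∃ s : ι → G, π ∘ s = t ∧ closure (Set.range s) = ⊤ := by
  classical
  have : Fintype (ι → G) := Fintype.ofFinite _
  have ht₀ : closure (Set.range (π ∘ s₀)) = ⊤ := by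
    rw [← map_closure_range, hs₀, map_top_of_surjective π hπ]
  have hpos : 0 < (Finset.univ.filter fun s : ι → G =>
      π ∘ s = π ∘ s₀ ∧ closure (Set.range s) = ⊤).card :=
    Finset.card_pos.mpr ⟨s₀, by simp [hs₀]⟩
  rw [card_lifts_generating_eq π ht₀ ht] at hpos
  obtain ⟨s, hs⟩ := Finset.card_pos.mp hpos
  exact ⟨s, (Finset.mem_filter.mp hs).2⟩

end Gaschutz

theorem exists_finset_card_eq_minGen (G : Type*) [Group G] [Finite G] :
    ∃ S : Finset G, S.card = minGen G ∧ closure (S : Set G) = ⊤ := by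
  have := Fintype.ofFinite G
  exact Nat.sInf_mem (s := {n | ∃ S : Finset G, S.card = n ∧ closure (S : Set G) = ⊤})
    ⟨_, Finset.univ, rfl, by simp⟩

theorem exists_generating_tuple (G : Type*) [Group G] [Finite G] :
    ∃ s : Fin (minGen G) → G, closure (Set.range s) = ⊤ := by
  obtain ⟨S, hcard, hS⟩ := exists_finset_card_eq_minGen G
  refine ⟨fun i => (S.equivFinOfCardEq hcard).symm i, ?_⟩
  have hrange := (S.equivFinOfCardEq hcard).symm.surjective.range_comp (Subtype.val : S → G)
  rw [← hS]
  congr 1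
  exact hrange.trans (by simp)

theorem minGen_le_of_surjective {G Q : Type*} [Group G] [Group Q] [Finite G] (π : G →* Q)
    (hπ : Function.Surjective π) : minGen Q ≤ minGen G := by
  classical
  obtain ⟨S, hcard, hS⟩ := exists_finset_card_eq_minGen G
  calc minGen Q ≤ (S.image π).card := Nat.sInf_le ⟨_, rfl, by
        rw [Finset.coe_image, ← MonoidHom.map_closure, hS, map_top_of_surjective π hπ]⟩
    _ ≤ S.card := Finset.card_image_le
    _ = minGen G := hcard

/-- Extend a tuple of length `k` to one of length `d` by appending copies of `1`. -/
def padOne {Q : Type*} [One Q] {k : ℕ} (d : ℕ) (x : Fin k → Q) (i : Fin d) : Q :=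
  if h : (i : ℕ) < k then x ⟨i, h⟩ else 1

theorem closure_range_padOne {Q : Type*} [Group Q] {k d : ℕ} (hkd : k ≤ d) {x : Fin k → Q}
    (hx : closure (Set.range x) = ⊤) : closure (Set.range (padOne d x)) = ⊤ := by
  refine top_le_iff.mp (hx.symm.le.trans (closure_mono ?_))
  rintro _ ⟨i, rfl⟩
  exact ⟨i.castLE hkd, by simp [padOne]⟩

/-- The MGSE property is inherited by quotients. -/
theorem mgse_quotient {G : Type*} [Group G] [Finite G] (h : MGSE G)
    (N : Subgroup G) [N.Normal] : MGSE (G ⧸ N) := by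
  intro x y hx hy i
  have hπ := QuotientGroup.mk'_surjective N
  have hle := minGen_le_of_surjective _ hπ
  obtain ⟨s₀, hs₀⟩ := exists_generating_tuple G
  obtain ⟨X, hX, hXgen⟩ := exists_generating_lift _ hπ hs₀ (closure_range_padOne hle hx)
  obtain ⟨Y, hY, hYgen⟩ := exists_generating_lift _ hπ hs₀ (closure_range_padOne hle hy)
  obtain ⟨j, hj⟩ := h X Y hXgen hYgen (i.castLE hle)
  have hgen := map_closure_range (QuotientGroup.mk' N) (Function.update X (i.castLE hle) (Y j))
  rw [hj, map_top_of_surjective _ hπ, Function.comp_update, hX,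
    show QuotientGroup.mk' N (Y j) = padOne _ y j from congrFun hY j] at hgen
  -- If `Y j` lies over a padding entry, then `x i` is redundant and any index works.
  have hexchange (l : Fin (minGen (G ⧸ N))) (hl : padOne _ y j = y l ∨ padOne _ y j = 1) :
      closure (Set.range (Function.update x i (y l))) = ⊤ := by
    rw [← top_le_iff, hgen, closure_le]
    rintro _ ⟨m, rfl⟩
    have hmem (r) : Function.update x i (y l) r ∈
        closure (Set.range (Function.update x i (y l))) := subset_closure ⟨r, rfl⟩
    by_cases hm : m = i.castLE hle
    · subst hm
      rw [Function.update_self]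
      rcases hl with hl | hl
      · simpa [hl] using hmem i
      · simp [hl, one_mem]
    · rw [Function.update_of_ne hm, padOne]
      split_ifs with hmk
      · have hne : (⟨m, hmk⟩ : Fin _) ≠ i := fun he => hm (by simp [← he])
        simpa [Function.update_of_ne hne] using hmem ⟨m, hmk⟩
      · exact one_mem _
  by_cases hjk : (j : ℕ) < minGen (G ⧸ N)
  · exact ⟨⟨j, hjk⟩, hexchange _ (.inl (by simp [padOne, hjk]))⟩
  · exact ⟨i, hexchange i (.inr (by simp [padOne, hjk]))⟩
end

section
/- Let G be a non-cyclic finite group which satisfies the MGSE property. If N is a normal subgroup of G such that G/N is cyclic, then G/N is a p-group for some prime p. In particular, the abelianization G/[G,G] is a p-group for some prime p. -/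
/-- A tuple generates as soon as its closure contains the entries of a generating tuple. -/
theorem closure_range_eq_top_of_forall_mem {G ι κ : Type*} [Group G] {x : ι → G} {y : κ → G}
    (hx : Subgroup.closure (Set.range x) = ⊤)
    (h : ∀ i, x i ∈ Subgroup.closure (Set.range y)) :
    Subgroup.closure (Set.range y) = ⊤ := by
  rw [eq_top_iff, ← hx, Subgroup.closure_le]
  rintro _ ⟨i, rfl⟩
  exact h i

/-- A generating tuple has an entry outside any given proper subgroup. -/
theorem exists_notMem_of_closure_range_eq_top {G ι : Type*} [Group G] {x : ι → G}
    (hx : Subgroup.closure (Set.range x) = ⊤) {A : Subgroup G} (hA : A ≠ ⊤) :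
    ∃ i, x i ∉ A := by
  by_contra! hc
  apply hA
  rw [eq_top_iff, ← hx, Subgroup.closure_le]
  rintro _ ⟨i, rfl⟩
  exact hc i

/-- A finite group has a generating tuple of length `minGen G`. -/
theorem exists_closure_range_eq_top (G : Type*) [Group G] [Finite G] :
    ∃ x : Fin (minGen G) → G, Subgroup.closure (Set.range x) = ⊤ := by
  have hne : {n | ∃ S : Finset G, S.card = n ∧ Subgroup.closure (S : Set G) = ⊤}.Nonempty := by
    have := Fintype.ofFinite G
    exact ⟨_, Finset.univ, rfl, by simp⟩
  obtain ⟨S, hcard, hS⟩ : ∃ S : Finset G, S.card = minGen G ∧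
      Subgroup.closure (S : Set G) = ⊤ := Nat.sInf_mem hne
  refine ⟨fun i => (S.equivFinOfCardEq hcard).symm i, ?_⟩
  refine (congrArg Subgroup.closure ?_).trans hS
  ext g
  constructor
  · rintro ⟨i, rfl⟩
    exact ((S.equivFinOfCardEq hcard).symm i).2
  · intro hg
    exact ⟨S.equivFinOfCardEq hcard ⟨g, hg⟩, by simp⟩

/-- A group generated by a tuple indexed by a subsingleton is cyclic. -/
theorem isCyclic_of_closure_range_eq_top {G ι : Type*} [Group G] [Subsingleton ι] {x : ι → G}
    (hx : Subgroup.closure (Set.range x) = ⊤) : IsCyclic G := by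
  rcases isEmpty_or_nonempty ι with hι | ⟨⟨i⟩⟩
  · refine ⟨1, fun g => ?_⟩
    have hg : g ∈ Subgroup.closure (Set.range x) := hx ▸ Subgroup.mem_top g
    rw [Set.range_eq_empty, Subgroup.closure_empty] at hg
    simpa [eq_comm] using hg
  · refine ⟨x i, fun g => ?_⟩
    have hg : g ∈ Subgroup.closure (Set.range x) := hx ▸ Subgroup.mem_top g
    refine (Subgroup.closure_le (Subgroup.zpowers (x i))).2 ?_ hg
    rintro _ ⟨j, rfl⟩
    rw [Subsingleton.elim j i]
    exact Subgroup.mem_zpowers _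

/-- `A` is a proper normal subgroup whose quotient has exponent dividing `p` and is generated by
any of its nontrivial elements. -/
structure IsPrimeQuotient {G : Type*} [Group G] (p : ℕ) (A : Subgroup G) : Prop where
  normal : A.Normal
  ne_top : A ≠ ⊤
  pow_mem : ∀ g, g ^ p ∈ A
  exists_mul_zpow_mem : ∀ e ∉ A, ∀ g, ∃ m : ℤ, g * e ^ m ∈ A

theorem IsPrimeQuotient.zpow_mem {G : Type*} [Group G] {p : ℕ} {A : Subgroup G}
    (hA : IsPrimeQuotient p A) (g : G) {m : ℤ} (hm : (p : ℤ) ∣ m) : g ^ m ∈ A := by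
  obtain ⟨k, rfl⟩ := hm
  rw [zpow_mul, zpow_natCast]
  exact A.zpow_mem (hA.pow_mem g) k

theorem IsPrimeQuotient.comap {G H : Type*} [Group G] [Group H] {p : ℕ} {A : Subgroup H}
    (hA : IsPrimeQuotient p A) {f : G →* H} (hf : Function.Surjective f) :
    IsPrimeQuotient p (A.comap f) where
  normal := hA.normal.comap f
  ne_top h := hA.ne_top (Subgroup.comap_injective hf (h.trans (Subgroup.comap_top f).symm))
  pow_mem g := by simpa using hA.pow_mem (f g)
  exists_mul_zpow_mem e he g := by simpa using hA.exists_mul_zpow_mem (f e) he (f g)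

/-- A finite commutative group has a quotient of order `p` for each prime `p` dividing its
order. -/
theorem exists_isPrimeQuotient {H : Type*} [CommGroup H] [Finite H] {p : ℕ} (hp : p.Prime)
    (hdvd : p ∣ Nat.card H) : ∃ A : Subgroup H, IsPrimeQuotient p A := by
  have : Fact p.Prime := ⟨hp⟩
  have hne : (powMonoidHom p : H →* H).range ≠ ⊤ := by
    intro htop
    have hinj := Finite.injective_iff_surjective.2 (MonoidHom.range_eq_top.1 htop)
    obtain ⟨g, hg⟩ := exists_prime_orderOf_dvd_card' p hdvd
    have hg1 : g = 1 := hinj (by simp [← hg, pow_orderOf_eq_one])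
    rw [hg1, orderOf_one] at hg
    exact hp.one_lt.ne hg
  obtain ⟨A, hA, hle⟩ := (eq_top_or_exists_le_coatom _).resolve_left hne
  refine ⟨A, inferInstance, hA.1, fun g => hle ⟨g, rfl⟩, fun e he g => ?_⟩
  have htop : A ⊔ Subgroup.zpowers e = ⊤ := by
    apply hA.2
    refine lt_of_le_of_ne le_sup_left fun heq => he ?_
    rw [heq]
    exact Subgroup.mem_sup_right (Subgroup.mem_zpowers e)
  have hg : g ∈ A ⊔ Subgroup.zpowers e := htop ▸ Subgroup.mem_top g
  obtain ⟨a, ha, _, ⟨m, rfl⟩, rfl⟩ := Subgroup.mem_sup.1 hg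
  exact ⟨-m, by simpa using ha⟩

theorem exists_int_dvd_sub_and_dvd_sub {p q : ℕ} (h : p.Coprime q) (a b : ℤ) :
    ∃ m : ℤ, (p : ℤ) ∣ m - a ∧ (q : ℤ) ∣ m - b := by
  obtain ⟨u, v, huv⟩ := Nat.isCoprime_iff_coprime.2 h
  refine ⟨u * p * b + v * q * a, ⟨u * (b - a), ?_⟩, ⟨v * (a - b), ?_⟩⟩
  · linear_combination a * huv
  · linear_combination b * huv

/-- An element outside both `A` and `B` generates the group modulo `A ⊓ B`. -/
theorem IsPrimeQuotient.exists_mul_zpow_mem_inf {G : Type*} [Group G] {p q : ℕ}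
    {A B : Subgroup G} (hA : IsPrimeQuotient p A) (hB : IsPrimeQuotient q B) (h : p.Coprime q)
    {e : G} (heA : e ∉ A) (heB : e ∉ B) (g : G) :
    ∃ m : ℤ, g * e ^ m ∈ A ∧ g * e ^ m ∈ B := by
  obtain ⟨a, ha⟩ := hA.exists_mul_zpow_mem e heA g
  obtain ⟨b, hb⟩ := hB.exists_mul_zpow_mem e heB g
  obtain ⟨m, hma, hmb⟩ := exists_int_dvd_sub_and_dvd_sub h a b
  refine ⟨m, ?_, ?_⟩
  · simpa [mul_assoc, ← zpow_add] using A.mul_mem ha (hA.zpow_mem e hma)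
  · simpa [mul_assoc, ← zpow_add] using B.mul_mem hb (hB.zpow_mem e hmb)

/-- A generating tuple can be changed so that one entry avoids two given proper subgroups. -/
theorem exists_closure_range_eq_top_notMem {G ι : Type*} [Group G] [DecidableEq ι] {x : ι → G}
    (hx : Subgroup.closure (Set.range x) = ⊤) {A B : Subgroup G} (hA : A ≠ ⊤) (hB : B ≠ ⊤) :
    ∃ (y : ι → G) (i : ι), Subgroup.closure (Set.range y) = ⊤ ∧ y i ∉ A ∧ y i ∉ B := by
  obtain ⟨i, hi⟩ := exists_notMem_of_closure_range_eq_top hx hA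
  obtain ⟨j, hj⟩ := exists_notMem_of_closure_range_eq_top hx hB
  by_cases hiB : x i ∈ B
  swap
  · exact ⟨x, i, hx, hi, hiB⟩
  by_cases hjA : x j ∈ A
  swap
  · exact ⟨x, j, hx, hjA, hj⟩
  have hij : j ≠ i := by
    rintro rfl
    exact hi hjA
  refine ⟨Function.update x i (x i * x j), i, ?_, ?_, ?_⟩
  · have hmem (k : ι) : Function.update x i (x i * x j) k ∈
        Subgroup.closure (Set.range (Function.update x i (x i * x j))) :=
      Subgroup.subset_closure ⟨k, rfl⟩
    refine closure_range_eq_top_of_forall_mem hx fun k => ?_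
    by_cases hk : k = i
    · subst hk
      have h₁ := hmem k
      have h₂ := hmem j
      simp only [Function.update_self, Function.update_of_ne hij] at h₁ h₂
      exact (Subgroup.mul_mem_cancel_right _ h₂).1 h₁
    · simpa [hk] using hmem k
  · simpa [Subgroup.mul_mem_cancel_right _ hjA] using hi
  · simpa [Subgroup.mul_mem_cancel_left _ hiB] using hj

/-- A generating tuple can be changed so that all entries but one lie in `A ⊓ B`. -/
theorem exists_closure_range_eq_top_mem_inf {G ι : Type*} [Group G] [DecidableEq ι] {x : ι → G}
    (hx : Subgroup.closure (Set.range x) = ⊤) {p q : ℕ} (h : p.Coprime q) {A B : Subgroup G}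
    (hA : IsPrimeQuotient p A) (hB : IsPrimeQuotient q B) :
    ∃ (y : ι → G) (i : ι), Subgroup.closure (Set.range y) = ⊤ ∧
      ∀ k ≠ i, y k ∈ A ∧ y k ∈ B := by
  obtain ⟨z, i, hz, hiA, hiB⟩ := exists_closure_range_eq_top_notMem hx hA.ne_top hB.ne_top
  choose m hm using hA.exists_mul_zpow_mem_inf hB h hiA hiB
  let y : ι → G := fun k => if k = i then z i else z k * z i ^ m (z k)
  have hyi : y i = z i := if_pos rfl
  have hyk (k : ι) (hk : k ≠ i) : y k = z k * z i ^ m (z k) := if_neg hk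
  have hmem (k : ι) : y k ∈ Subgroup.closure (Set.range y) := Subgroup.subset_closure ⟨k, rfl⟩
  have hzi : z i ∈ Subgroup.closure (Set.range y) := hyi ▸ hmem i
  refine ⟨y, i, closure_range_eq_top_of_forall_mem hz fun k => ?_,
    fun k hk => hyk k hk ▸ hm (z k)⟩
  by_cases hk : k = i
  · rwa [hk]
  · have hk' := hmem k
    rw [hyk k hk] at hk'
    exact (Subgroup.mul_mem_cancel_right _ (Subgroup.zpow_mem _ hzi _)).1 hk'

/-- A generating tuple with at most one entry outside `A ⊓ B` can be changed so that every entry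
lies in `A` or in `B`. -/
theorem exists_closure_range_eq_top_mem_or_mem {G ι : Type*} [Group G] [DecidableEq ι]
    [Nontrivial ι] {x : ι → G} (hx : Subgroup.closure (Set.range x) = ⊤) {p q : ℕ}
    (h : p.Coprime q) {A B : Subgroup G} (hA : IsPrimeQuotient p A) (hB : IsPrimeQuotient q B)
    {i : ι} (hi : ∀ k ≠ i, x k ∈ A ∧ x k ∈ B) :
    ∃ y : ι → G, Subgroup.closure (Set.range y) = ⊤ ∧ ∀ k, y k ∈ A ∨ y k ∈ B := by
  obtain ⟨j, hj⟩ := exists_ne i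
  obtain ⟨m, hmp, hmq⟩ := exists_int_dvd_sub_and_dvd_sub h 1 0
  let b := x j * x i ^ m
  let y : ι → G := Function.update (Function.update x j b) i (x i * b⁻¹)
  have hyi : y i = x i * b⁻¹ := by simp [y]
  have hyj : y j = b := by simp [y, hj]
  have hyk (k : ι) (hki : k ≠ i) (hkj : k ≠ j) : y k = x k := by simp [y, hki, hkj]
  have hmem (k : ι) : y k ∈ Subgroup.closure (Set.range y) := Subgroup.subset_closure ⟨k, rfl⟩
  have hb : b ∈ Subgroup.closure (Set.range y) := hyj ▸ hmem j
  have hxi : x i ∈ Subgroup.closure (Set.range y) :=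
    (Subgroup.mul_mem_cancel_right _ (Subgroup.inv_mem _ hb)).1 (hyi ▸ hmem i)
  refine ⟨y, closure_range_eq_top_of_forall_mem hx fun k => ?_, fun k => ?_⟩
  · by_cases hki : k = i
    · rwa [hki]
    by_cases hkj : k = j
    · rw [hkj]
      exact (Subgroup.mul_mem_cancel_right _ (Subgroup.zpow_mem _ hxi m)).1 hb
    · exact hyk k hki hkj ▸ hmem k
  · by_cases hki : k = i
    · left
      have hpow : x i * b⁻¹ = (x i ^ (m - 1))⁻¹ * (x j)⁻¹ := by
        simp only [b]
        group
      rw [hki, hyi, hpow]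
      exact A.mul_mem (A.inv_mem (hA.zpow_mem _ hmp)) (A.inv_mem (hi j hj).1)
    by_cases hkj : k = j
    · right
      rw [hkj, hyj]
      exact B.mul_mem (hi j hj).2 (hB.zpow_mem _ (by simpa using hmq))
    · exact Or.inl (hyk k hki hkj ▸ (hi k hki).1)

/-- A noncyclic finite group with the MGSE property does not have quotients of two distinct prime
orders. -/
theorem MGSE.not_isPrimeQuotient {G : Type*} [Group G] [Finite G] (hnc : ¬ IsCyclic G)
    (hG : MGSE G) {p q : ℕ} (h : p.Coprime q) {A B : Subgroup G} (hA : IsPrimeQuotient p A) :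
    ¬ IsPrimeQuotient q B := by
  intro hB
  obtain ⟨w, hw⟩ := exists_closure_range_eq_top G
  have : Nontrivial (Fin (minGen G)) := by
    rw [← not_subsingleton_iff_nontrivial]
    exact fun _ => hnc (isCyclic_of_closure_range_eq_top hw)
  obtain ⟨x, i, hx, hi⟩ := exists_closure_range_eq_top_mem_inf hw h hA hB
  obtain ⟨y, hy, hyAB⟩ := exists_closure_range_eq_top_mem_or_mem hx h hA hB hi
  obtain ⟨j, hj⟩ := hG x y hx hy i
  rcases hyAB j with hjA | hjB
  · obtain ⟨k, hk⟩ := exists_notMem_of_closure_range_eq_top hj hA.ne_top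
    by_cases hki : k = i
    · simp [hki, hjA] at hk
    · simp [hki, (hi k hki).1] at hk
  · obtain ⟨k, hk⟩ := exists_notMem_of_closure_range_eq_top hj hB.ne_top
    by_cases hki : k = i
    · simp [hki, hjB] at hk
    · simp [hki, (hi k hki).2] at hk

/-- A commutative quotient of a noncyclic finite group with the MGSE property is a `p`-group. -/
theorem MGSE.exists_isPGroup_of_surjective {G H : Type*} [Group G] [Finite G] [CommGroup H]
    (hnc : ¬ IsCyclic G) (hG : MGSE G) {f : G →* H} (hf : Function.Surjective f) :
    ∃ p : ℕ, p.Prime ∧ IsPGroup p H := by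
  have : Finite H := Finite.of_surjective f hf
  by_cases hcard : Nat.card H = 1
  · exact ⟨2, Nat.prime_two, IsPGroup.of_card (n := 0) (by simpa using hcard)⟩
  obtain ⟨p, hp, hdvd⟩ := Nat.exists_prime_and_dvd hcard
  refine ⟨p, hp, IsPGroup.of_card
    (Nat.eq_prime_pow_of_unique_prime_dvd Nat.card_pos.ne' fun {q} hq hqdvd => ?_)⟩
  by_contra hne
  obtain ⟨A, hA⟩ := exists_isPrimeQuotient hp hdvd
  obtain ⟨B, hB⟩ := exists_isPrimeQuotient hq hqdvd
  exact hG.not_isPrimeQuotient hnc ((Nat.coprime_primes hp hq).2 (Ne.symm hne))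
    (hA.comap hf) (hB.comap hf)

/-- If a non-cyclic finite group `G` satisfies the MGSE property, then every cyclic
quotient of `G` is a `p`-group for some prime `p`; in particular the abelianization
`G/[G,G]` is a `p`-group for some prime `p`. -/
theorem cyclic_quotient_is_pGroup_of_mgse {G : Type*} [Group G] [Finite G]
    (hnc : ¬ IsCyclic G) (h : MGSE G) :
    (∀ (N : Subgroup G) [N.Normal], IsCyclic (G ⧸ N) →
        ∃ p : ℕ, p.Prime ∧ IsPGroup p (G ⧸ N)) ∧
      ∃ p : ℕ, p.Prime ∧ IsPGroup p (Abelianization G) := by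
  refine ⟨fun N _ hN => ?_, ?_⟩
  · let _ : CommGroup (G ⧸ N) := IsCyclic.commGroup
    exact h.exists_isPGroup_of_surjective hnc (QuotientGroup.mk'_surjective N)
  · exact h.exists_isPGroup_of_surjective hnc (f := Abelianization.of)
      (QuotientGroup.mk'_surjective _)
end

section
/- Let G be a finite solvable non-nilpotent group with d(G) = 2 satisfying the MGSE property. Then G/Frat(G) is isomorphic to a semidirect product V ⋊ ⟨x⟩, where x has prime order and V is a faithful irreducible ⟨x⟩-module; that is, the group Q = G/Frat(G) has an abelian normal subgroup V which is a minimal normal subgroup of Q (V ≠ 1 and no nontrivial proper subgroup of V is normal in Q), and V has a complement H = ⟨x⟩ in Q which is cyclic of prime order and satisfies C_H(V) = 1. -/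
section Auxiliary

open Subgroup

/-- `a` and `b` generate the whole group. -/
def GeneratingPair {Q : Type*} [Group Q] (a b : Q) : Prop :=
  closure {a, b} = (⊤ : Subgroup Q)

/-- Any member of a generating pair can be joined to one of the members of any other
generating pair. -/
def PairExchange (Q : Type*) [Group Q] : Prop :=
  ∀ a a' b c : Q, GeneratingPair a a' → GeneratingPair b c →
    GeneratingPair a b ∨ GeneratingPair a c

/-- `V` is minimal among the nontrivial normal subgroups. -/
structure IsMinimalNormal {Q : Type*} [Group Q] (V : Subgroup Q) : Prop where
  normal : V.Normal
  ne_bot : V ≠ ⊥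
  eq_bot_or_eq : ∀ W : Subgroup Q, W ≤ V → W.Normal → W = ⊥ ∨ W = V

/-- An endomorphism that induces a section of the quotient map by `V`. -/
structure IsSectionModulo {Q : Type*} [Group Q] (V : Subgroup Q) (s : Q →* Q) : Prop where
  map_eq_one : ∀ v ∈ V, s v = 1
  map_mul_inv_mem : ∀ g, s g * g⁻¹ ∈ V

section Pairs

variable {Q : Type*} [Group Q]

theorem GeneratingPair.symm {a b : Q} (h : GeneratingPair a b) : GeneratingPair b a := by
  rw [GeneratingPair, Set.pair_comm]
  exact h

theorem GeneratingPair.eq_top {a b : Q} (h : GeneratingPair a b) {K : Subgroup Q}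
    (ha : a ∈ K) (hb : b ∈ K) : K = ⊤ := by
  rw [eq_top_iff, ← h, closure_le]
  rintro z (rfl | rfl) <;> assumption

theorem left_mem_closure_pair (a b : Q) : a ∈ closure ({a, b} : Set Q) :=
  subset_closure (by simp)

theorem right_mem_closure_pair (a b : Q) : b ∈ closure ({a, b} : Set Q) :=
  subset_closure (by simp)

theorem GeneratingPair.of_mem {a b c d : Q} (h : GeneratingPair a b)
    (ha : a ∈ closure ({c, d} : Set Q)) (hb : b ∈ closure ({c, d} : Set Q)) :
    GeneratingPair c d :=
  h.eq_top ha hb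

theorem GeneratingPair.mul_left {a b : Q} (h : GeneratingPair a b) :
    GeneratingPair (a * b) b := by
  refine h.of_mem ?_ (right_mem_closure_pair _ _)
  simpa using mul_mem (left_mem_closure_pair (a * b) b) (inv_mem (right_mem_closure_pair (a * b) b))

theorem GeneratingPair.mul_right {a b : Q} (h : GeneratingPair a b) :
    GeneratingPair a (a * b) := by
  refine h.of_mem (left_mem_closure_pair _ _) ?_
  simpa using mul_mem (inv_mem (left_mem_closure_pair a (a * b))) (right_mem_closure_pair a (a * b))

/-- Two congruent generators force the quotient to be cyclic. -/
theorem GeneratingPair.isCyclic_quotient {V : Subgroup Q} [V.Normal] {a b : Q}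
    (h : GeneratingPair a b) (hab : b * a⁻¹ ∈ V) : IsCyclic (Q ⧸ V) := by
  have hK := h.eq_top (K := (zpowers (QuotientGroup.mk' V a)).comap (QuotientGroup.mk' V))
    (mem_zpowers _) (by
      have : QuotientGroup.mk' V b = QuotientGroup.mk' V a := by
        rw [← mul_inv_eq_one, ← map_inv, ← map_mul]
        exact (QuotientGroup.eq_one_iff _).2 hab
      rw [mem_comap, this]
      exact mem_zpowers _)
  refine ⟨⟨QuotientGroup.mk' V a, fun q => ?_⟩⟩
  obtain ⟨g, rfl⟩ := QuotientGroup.mk'_surjective V q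
  exact mem_comap.1 (hK ▸ mem_top g)

end Pairs

section Sections

variable {Q : Type*} [Group Q] {V : Subgroup Q}

/-- Sections modulo an abelian normal subgroup form a heap. -/
theorem IsSectionModulo.exists_heap [V.Normal] (hab : ∀ a ∈ V, ∀ b ∈ V, a * b = b * a)
    {s t r : Q →* Q} (hs : IsSectionModulo V s) (ht : IsSectionModulo V t)
    (hr : IsSectionModulo V r) :
    ∃ u : Q →* Q, IsSectionModulo V u ∧ ∀ g, u g = s g * (t g)⁻¹ * r g := by
  have hst : ∀ g, s g * (t g)⁻¹ ∈ V := fun g => by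
    simpa [mul_assoc] using mul_mem (hs.map_mul_inv_mem g) (inv_mem (ht.map_mul_inv_mem g))
  have htr : ∀ g, (t g)⁻¹ * r g ∈ V := fun g => by
    have h₁ : r g * (t g)⁻¹ ∈ V := by
      simpa [mul_assoc] using mul_mem (hr.map_mul_inv_mem g) (inv_mem (ht.map_mul_inv_mem g))
    exact Subgroup.Normal.mem_comm ‹_› h₁
  refine ⟨MonoidHom.mk' (fun g => s g * (t g)⁻¹ * r g) fun g h => ?_, ⟨fun v hv => ?_, fun g => ?_⟩,
    fun g => rfl⟩
  · have key := hab _ (hst h) _ (htr g)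
    calc s (g * h) * (t (g * h))⁻¹ * r (g * h)
        = s g * ((s h * (t h)⁻¹) * ((t g)⁻¹ * r g)) * r h := by
          simp only [map_mul, mul_inv_rev, mul_assoc]
      _ = s g * (t g)⁻¹ * r g * (s h * (t h)⁻¹ * r h) := by
          rw [key]
          simp only [mul_assoc]
  · simp [hs.map_eq_one v hv, ht.map_eq_one v hv, hr.map_eq_one v hv]
  · simpa [mul_assoc] using mul_mem (hst g) (hr.map_mul_inv_mem g)

/-- The range of a section modulo a nontrivial subgroup is proper. -/
theorem IsSectionModulo.range_ne_top [Finite Q] (hV : V ≠ ⊥) {s : Q →* Q}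
    (hs : IsSectionModulo V s) : s.range ≠ ⊤ := by
  intro h
  have hinj := Finite.injective_iff_surjective.2 (MonoidHom.range_eq_top.1 h)
  refine hV ((eq_bot_iff_forall _).2 fun v hv => hinj ?_)
  rw [hs.map_eq_one v hv, map_one]

theorem IsSectionModulo.not_generatingPair [Finite Q] (hV : V ≠ ⊥) {s : Q →* Q}
    (hs : IsSectionModulo V s) (a b : Q) : ¬ GeneratingPair (s a) (s b) :=
  fun h => hs.range_ne_top hV (h.eq_top ⟨a, rfl⟩ ⟨b, rfl⟩)

/-- A complement of a normal subgroup is the range of a section fixing it pointwise. -/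
theorem exists_isSectionModulo_of_isComplement' [V.Normal] {M : Subgroup Q}
    (h : M.IsComplement' V) :
    ∃ s : Q →* Q, IsSectionModulo V s ∧ (∀ g, s g ∈ M) ∧ ∀ m ∈ M, s m = m := by
  let e := h.QuotientMulEquiv
  have hmk : ∀ m : M, e.symm m = QuotientGroup.mk' V m := fun _ => rfl
  refine ⟨M.subtype.comp (e.toMonoidHom.comp (QuotientGroup.mk' V)), ⟨fun v hv => ?_, fun g => ?_⟩,
    fun g => (e (QuotientGroup.mk' V g)).2, fun m hm => ?_⟩
  · have : QuotientGroup.mk' V v = 1 := (QuotientGroup.eq_one_iff _).2 hv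
    simp only [MonoidHom.comp_apply, this, map_one]
  · have h₁ := hmk (e (QuotientGroup.mk' V g))
    rw [MulEquiv.symm_apply_apply] at h₁
    refine (QuotientGroup.eq_one_iff _).1 ?_
    change QuotientGroup.mk' V ((e (QuotientGroup.mk' V g) : Q) * g⁻¹) = 1
    rw [map_mul, ← h₁, map_inv, mul_inv_cancel]
  · have h₁ := hmk ⟨m, hm⟩
    change ((e (QuotientGroup.mk' V m) : M) : Q) = m
    rw [← h₁, MulEquiv.apply_symm_apply]

/-- A proper supplement of an abelian minimal normal subgroup is a complement. -/
theorem IsMinimalNormal.isComplement'_of_sup_eq_top (hV : IsMinimalNormal V)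
    (hab : ∀ a ∈ V, ∀ b ∈ V, a * b = b * a) {M : Subgroup Q} (hM : M ≠ ⊤)
    (hsup : M ⊔ V = ⊤) : M.IsComplement' V := by
  have := hV.normal
  have hdecomp : ∀ g : Q, ∃ m ∈ M, ∃ v ∈ V, m * v = g := fun g =>
    mem_sup_of_normal_right.1 (hsup ▸ mem_top g)
  have hnormal : (M ⊓ V).Normal := by
    refine ⟨fun n hn g => ?_⟩
    obtain ⟨m, hm, v, hv, rfl⟩ := hdecomp g
    have h₁ : m * v * n * (m * v)⁻¹ = m * n * m⁻¹ := by
      calc m * v * n * (m * v)⁻¹ = m * (v * n) * v⁻¹ * m⁻¹ := by group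
        _ = m * n * m⁻¹ := by rw [hab v hv n hn.2]; group
    rw [h₁]
    exact ⟨M.mul_mem (M.mul_mem hm hn.1) (M.inv_mem hm), hV.normal.conj_mem n hn.2 m⟩
  have hinf : M ⊓ V = ⊥ := by
    refine (hV.eq_bot_or_eq _ inf_le_right hnormal).resolve_right fun h => hM ?_
    rwa [sup_eq_left.2 (inf_eq_right.1 h)] at hsup
  refine isComplement'_of_disjoint_and_mul_eq_univ (disjoint_iff.2 hinf) ?_
  refine Set.eq_univ_of_forall fun g => ?_
  obtain ⟨m, hm, v, hv, hg⟩ := hdecomp g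
  exact ⟨m, hm, v, hv, hg⟩

/-- A lift of a pair of generators which does not generate comes from a section. -/
theorem GeneratingPair.exists_isSectionModulo (hV : IsMinimalNormal V)
    (hab : ∀ a ∈ V, ∀ b ∈ V, a * b = b * a) {x y x' y' : Q} (h : GeneratingPair x y)
    (hx : x' * x⁻¹ ∈ V) (hy : y' * y⁻¹ ∈ V) (h' : ¬ GeneratingPair x' y') :
    ∃ s : Q →* Q, IsSectionModulo V s ∧ s x = x' ∧ s y = y' := by
  have := hV.normal
  have hmem : ∀ {a a' : Q}, a' * a⁻¹ ∈ V → a' ∈ closure ({x', y'} : Set Q) →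
      a ∈ closure {x', y'} ⊔ V := fun {a a'} hV' ha => by
    simpa using mul_mem (inv_mem (mem_sup_right (S := closure ({x', y'} : Set Q)) hV'))
      (mem_sup_left (T := V) ha)
  have hcompl := hV.isComplement'_of_sup_eq_top hab h' (h.eq_top
    (hmem hx (left_mem_closure_pair _ _)) (hmem hy (right_mem_closure_pair _ _)))
  obtain ⟨s, hs, -, hfix⟩ := exists_isSectionModulo_of_isComplement' hcompl
  have hval : ∀ {a a' : Q}, a' * a⁻¹ ∈ V → a' ∈ closure ({x', y'} : Set Q) → s a = a' :=
    fun {a a'} hV' ha => by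
      have h₁ := hs.map_eq_one _ hV'
      rw [map_mul, map_inv, mul_inv_eq_one] at h₁
      rw [← h₁, hfix _ ha]
  exact ⟨s, hs, hval hx (left_mem_closure_pair _ _), hval hy (right_mem_closure_pair _ _)⟩

/-- Under a section modulo an abelian minimal normal subgroup, the image of some member of a
generating pair still belongs to a generating pair. -/
theorem GeneratingPair.exists_map_left_or_right [Finite Q] (hV : IsMinimalNormal V)
    (hab : ∀ a ∈ V, ∀ b ∈ V, a * b = b * a) {s : Q →* Q} (hs : IsSectionModulo V s) {x y : Q}
    (h : GeneratingPair x y) :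
    (∃ z, GeneratingPair (s x) z) ∨ ∃ z, GeneratingPair (s y) z := by
  by_contra! hcon
  have := hV.normal
  obtain ⟨t, ht, htx, hty⟩ := h.exists_isSectionModulo hV hab (hs.map_mul_inv_mem x)
    (by simp : y * y⁻¹ ∈ V) (hcon.1 y)
  obtain ⟨r, hr, hrx, hry⟩ := h.exists_isSectionModulo hV hab (by simp : x * x⁻¹ ∈ V)
    (hs.map_mul_inv_mem y) (fun h' => hcon.2 x h'.symm)
  obtain ⟨u, hu, hval⟩ := ht.exists_heap hab hs hr
  refine hu.not_generatingPair hV.ne_bot x y ?_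
  simpa [hval, htx, hty, hrx, hry] using h

/-- Under pair exchange, a section modulo `V` with noncyclic quotient cannot send both members
of a generating pair to members of generating pairs. -/
theorem PairExchange.not_map_left_and_right [Finite Q] (hQ : PairExchange Q) [V.Normal]
    (hV : V ≠ ⊥) (hcyc : ¬ IsCyclic (Q ⧸ V)) {s : Q →* Q} (hs : IsSectionModulo V s) {x y : Q}
    (h : GeneratingPair x y) :
    ¬ ((∃ z, GeneratingPair (s x) z) ∧ ∃ z, GeneratingPair (s y) z) := by
  rintro ⟨⟨z, hz⟩, ⟨w, hw⟩⟩
  have hself : ∀ a, ¬ GeneratingPair (s a) a := fun a ha =>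
    hcyc (ha.symm.isCyclic_quotient (hs.map_mul_inv_mem a))
  have h₁ := (hQ _ _ _ _ hz h).resolve_left (hself x)
  exact (hQ _ _ _ _ hw h₁).elim (hs.not_generatingPair hV y x) (hself y)

/-- Under pair exchange, the quotient by a complemented abelian minimal normal subgroup is
cyclic. -/
theorem PairExchange.isCyclic_quotient [Finite Q] (hQ : PairExchange Q)
    (hgen : ∃ x y : Q, GeneratingPair x y) [V.Normal] (hV : IsMinimalNormal V)
    (hab : ∀ a ∈ V, ∀ b ∈ V, a * b = b * a) {M : Subgroup Q} (hM : M.IsComplement' V) :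
    IsCyclic (Q ⧸ V) := by
  by_contra hcyc
  obtain ⟨x, y, h⟩ := hgen
  obtain ⟨s, hs, -, -⟩ := exists_isSectionModulo_of_isComplement' hM
  have hor := fun {a b : Q} (h : GeneratingPair a b) => h.exists_map_left_or_right hV hab hs
  have hnot := fun {a b : Q} (h : GeneratingPair a b) =>
    hQ.not_map_left_and_right hV.ne_bot hcyc hs h
  have h₁ := hor h
  have h₂ := hnot h
  have h₃ := hor h.mul_left
  have h₄ := hnot h.mul_left
  have h₅ := hor h.mul_right
  have h₆ := hnot h.mul_right
  generalize (∃ z, GeneratingPair (s x) z) = A at *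
  generalize (∃ z, GeneratingPair (s y) z) = B at *
  generalize (∃ z, GeneratingPair (s (x * y)) z) = C at *
  clear hor hnot
  tauto

end Sections

section MinimalNormal

variable {Q : Type*} [Group Q]

theorem exists_isMinimalNormal_le [Finite Q] {N : Subgroup Q} (hN : N.Normal) (hne : N ≠ ⊥) :
    ∃ V ≤ N, IsMinimalNormal V := by
  obtain ⟨V, hVN, hV⟩ := (Set.toFinite {W : Subgroup Q | W.Normal ∧ W ≠ ⊥}).exists_le_minimal
    (a := N) ⟨hN, hne⟩
  refine ⟨V, hVN, hV.prop.1, hV.prop.2, fun W hWV hW => ?_⟩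
  by_cases hbot : W = ⊥
  · exact Or.inl hbot
  · exact Or.inr (le_antisymm hWV (hV.le_of_le ⟨hW, hbot⟩ hWV))

theorem IsMinimalNormal.commute [Group.IsSolvable Q] {V : Subgroup Q} (hV : IsMinimalNormal V) :
    ∀ a ∈ V, ∀ b ∈ V, a * b = b * a := by
  have := hV.normal
  have hlt : ⁅V, V⁆ < V := Group.IsSolvable.commutator_lt_of_ne_bot hV.ne_bot
  have hbot := (hV.eq_bot_or_eq _ hlt.le inferInstance).resolve_right hlt.ne
  intro a ha b hb
  rw [← commutatorElement_eq_one_iff_mul_comm, ← mem_bot, ← hbot]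
  exact commutator_mem_commutator ha hb

/-- A minimal normal subgroup avoiding some maximal subgroup is complemented by it. -/
theorem IsMinimalNormal.isComplement'_of_isCoatom {V : Subgroup Q} (hV : IsMinimalNormal V)
    (hab : ∀ a ∈ V, ∀ b ∈ V, a * b = b * a) {M : Subgroup Q} (hM : IsCoatom M) (hle : ¬ V ≤ M) :
    M.IsComplement' V :=
  hV.isComplement'_of_sup_eq_top hab hM.1 (hM.2 _ (left_lt_sup.2 hle))

end MinimalNormal

section Frattini

variable {G : Type*} [Group G]

theorem frattini_quotient_frattini : frattini (G ⧸ frattini G) = ⊥ := by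
  refine (eq_bot_iff_forall _).2 fun q hq => ?_
  obtain ⟨g, rfl⟩ := QuotientGroup.mk'_surjective _ q
  refine (QuotientGroup.eq_one_iff g).2 ?_
  change g ∈ Order.radical (Subgroup G)
  simp only [Order.radical, mem_iInf]
  intro K hK
  have hcomap : (K.map (QuotientGroup.mk' (frattini G))).comap (QuotientGroup.mk' _) = K := by
    rw [comap_map_eq, QuotientGroup.ker_mk', sup_eq_left]
    exact frattini_le_coatom hK
  have hmap : IsCoatom (K.map (QuotientGroup.mk' (frattini G))) := by
    refine ⟨fun h => hK.1 ?_, fun L hL => ?_⟩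
    · rw [← hcomap, h, comap_top]
    · have hlt := (comap_lt_comap_of_surjective (QuotientGroup.mk'_surjective (frattini G))).2 hL
      rw [hcomap] at hlt
      rw [← map_comap_eq_self_of_surjective (QuotientGroup.mk'_surjective _) L, hK.2 _ hlt,
        map_top_of_surjective _ (QuotientGroup.mk'_surjective _)]
  rw [← hcomap]
  exact frattini_le_coatom hmap hq

theorem exists_isCoatom_not_le_of_frattini_eq_bot (hfrat : frattini G = ⊥) {V : Subgroup G}
    (hV : V ≠ ⊥) : ∃ M : Subgroup G, IsCoatom M ∧ ¬ V ≤ M := by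
  by_contra! h
  refine hV (le_bot_iff.1 ?_)
  rw [← hfrat]
  exact le_iInf₂ h

/-- A finite group with abelian Frattini quotient is nilpotent. -/
theorem isNilpotent_of_quotient_frattini_comm [Finite G]
    (h : ∀ a b : G ⧸ frattini G, a * b = b * a) : Group.IsNilpotent G := by
  have htfae := (Group.isNilpotent_of_finite_tfae (G := G)).out 0 2
  refine htfae.2 fun K hK => ⟨fun n hn g => ?_⟩
  have h₁ : g * n * g⁻¹ * n⁻¹ ∈ frattini G := by
    refine (QuotientGroup.eq_one_iff _).1 ?_
    have := h g n
    simp only [QuotientGroup.mk_mul, QuotientGroup.mk_inv]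
    rw [this]
    group
  simpa using mul_mem (frattini_le_coatom hK h₁) hn

theorem GeneratingPair.of_quotient_frattini [Finite G] {a b : G}
    (h : GeneratingPair (a : G ⧸ frattini G) b) : GeneratingPair a b := by
  refine frattini_nongenerating ?_
  have h₁ := h.eq_top (K := (closure {a, b}).map (QuotientGroup.mk' (frattini G)))
    ⟨a, left_mem_closure_pair a b, rfl⟩ ⟨b, right_mem_closure_pair a b, rfl⟩
  have h₂ := comap_map_eq (QuotientGroup.mk' (frattini G)) (closure {a, b})
  rwa [h₁, comap_top, QuotientGroup.ker_mk', eq_comm] at h₂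

theorem GeneratingPair.map {H : Type*} [Group H] {a b : G} (h : GeneratingPair a b)
    {f : G →* H} (hf : Function.Surjective f) : GeneratingPair (f a) (f b) := by
  rw [GeneratingPair, ← Set.image_pair, ← MonoidHom.map_closure, h, map_top_of_surjective _ hf]

theorem PairExchange.quotient_frattini [Finite G] (h : PairExchange G) :
    PairExchange (G ⧸ frattini G) := by
  intro a a' b b' ha hb
  obtain ⟨a, rfl⟩ := QuotientGroup.mk'_surjective _ a
  obtain ⟨a', rfl⟩ := QuotientGroup.mk'_surjective _ a'
  obtain ⟨b, rfl⟩ := QuotientGroup.mk'_surjective _ b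
  obtain ⟨b', rfl⟩ := QuotientGroup.mk'_surjective _ b'
  exact (h a a' b b' ha.of_quotient_frattini hb.of_quotient_frattini).imp
    (fun h => h.map (QuotientGroup.mk'_surjective _))
    (fun h => h.map (QuotientGroup.mk'_surjective _))

end Frattini

section MinGen

variable {G : Type*} [Group G]

theorem exists_generatingPair_of_minGen_eq_two (hd : minGen G = 2) :
    ∃ x y : G, GeneratingPair x y := by
  have hmem : minGen G ∈ {n | ∃ S : Finset G, S.card = n ∧ closure (S : Set G) = ⊤} :=
    Nat.sInf_mem (Nat.nonempty_of_pos_sInf (by rw [← minGen, hd]; norm_num))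
  obtain ⟨S, hcard, hS⟩ := hmem
  classical
  obtain ⟨x, y, -, rfl⟩ := Finset.card_eq_two.1 (hcard.trans hd)
  exact ⟨x, y, by simpa [GeneratingPair] using hS⟩

theorem MGSE.pairExchange (hd : minGen G = 2) (h : MGSE G) : PairExchange G := by
  intro a a' b b' ha hb
  unfold MGSE at h
  rw [hd] at h
  have hrange : ∀ f : Fin 2 → G, Set.range f = {f 0, f 1} := fun f => by
    ext
    simp [Fin.exists_fin_two, eq_comm]
  simp only [hrange] at h
  obtain ⟨j, hj⟩ := h ![a, a'] ![b, b'] ha hb 1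
  fin_cases j
  · exact Or.inl hj
  · exact Or.inr hj

end MinGen

section Structure

variable {Q : Type*} [Group Q]

/-- Under pair exchange, a nonabelian solvable group with trivial Frattini subgroup has trivial
center. -/
theorem PairExchange.center_eq_bot [Finite Q] [Group.IsSolvable Q] (hQ : PairExchange Q)
    (hgen : ∃ x y : Q, GeneratingPair x y) (hfrat : frattini Q = ⊥)
    (hna : ¬ ∀ a b : Q, a * b = b * a) : center Q = ⊥ := by
  by_contra hne
  obtain ⟨V, hVZ, hV⟩ := exists_isMinimalNormal_le inferInstance hne
  have := hV.normal
  obtain ⟨M, hM, hVM⟩ := exists_isCoatom_not_le_of_frattini_eq_bot hfrat hV.ne_bot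
  have := hQ.isCyclic_quotient hgen hV hV.commute (hV.isComplement'_of_isCoatom hV.commute hM hVM)
  exact hna ((QuotientGroup.mk' V).isMulCommutative_of_isCyclic_of_ker_le_center
    (by rwa [QuotientGroup.ker_mk'])).is_comm.comm

/-- Under pair exchange, if the center is trivial then every nontrivial element of a maximal
cyclic complement generates it. -/
theorem PairExchange.mem_zpowers_of_isCoatom (hQ : PairExchange Q) (hcenter : center Q = ⊥)
    {V : Subgroup Q} [V.Normal] (hVne : V ≠ ⊥) {m : Q} (hM : IsCoatom (zpowers m))
    (hcompl : (zpowers m).IsComplement' V) {r : Q} (hr : r ∈ zpowers m) (hr₁ : r ≠ 1) :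
    m ∈ zpowers r := by
  have hdisj : ∀ {g : Q}, g ∈ zpowers m → g ∈ V → g = 1 := fun hg hg' =>
    Subgroup.disjoint_def.1 hcompl.disjoint hg hg'
  have hmax : ∀ g ∉ zpowers m, GeneratingPair m g := by
    intro g hg
    refine hM.2 _ (lt_of_le_of_ne (zpowers_le.2 (left_mem_closure_pair m g)) fun heq => hg ?_)
    rw [heq]
    exact right_mem_closure_pair m g
  obtain ⟨v, hv, hv₁⟩ := V.bot_or_exists_ne_one.resolve_left hVne
  have hvM : v ∉ zpowers m := fun h => hv₁ (hdisj h hv)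
  have hmv := hmax v hvM
  have hrv : v * r * v⁻¹ ∉ zpowers m := by
    intro hmem
    have hcomm : v * r * v⁻¹ * r⁻¹ = 1 := by
      refine hdisj (mul_mem hmem (inv_mem hr)) ?_
      simpa [mul_assoc] using mul_mem hv (Subgroup.Normal.conj_mem ‹_› v⁻¹ (inv_mem hv) r)
    have hmr : m ∈ centralizer {r} := by
      rw [mem_centralizer_singleton_iff]
      obtain ⟨k, rfl⟩ := mem_zpowers_iff.1 hr
      exact (Commute.self_zpow m k).eq
    have hvr : v ∈ centralizer {r} := by
      rw [mem_centralizer_singleton_iff]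
      rwa [mul_inv_eq_one, mul_inv_eq_iff_eq_mul] at hcomm
    have htop := hmv.eq_top hmr hvr
    refine hr₁ ?_
    rw [← mem_bot, ← hcenter, mem_center_iff]
    intro g
    exact mem_centralizer_singleton_iff.1 (htop ▸ mem_top g)
  have hpair : GeneratingPair r (v⁻¹ * m * v) := by
    have := (hmax _ hrv).symm.map (f := (MulAut.conj v⁻¹).toMonoidHom) (MulAut.conj v⁻¹).surjective
    simpa [mul_assoc] using this
  rcases hQ _ _ _ _ hpair hmv with h | h
  · exact absurd (h.eq_top hr (mem_zpowers m)) hM.1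
  · have htop := h.eq_top (K := zpowers r ⊔ V) (mem_sup_left (mem_zpowers r)) (mem_sup_right hv)
    obtain ⟨g, hg, w, hw, hgw⟩ := mem_sup_of_normal_right.1 (htop ▸ mem_top m)
    have hgm : g ∈ zpowers m := zpowers_le.2 hr hg
    have hw₁ : w = 1 := by
      refine hdisj ?_ hw
      rw [← inv_mul_eq_iff_eq_mul.2 hgw.symm]
      exact mul_mem (inv_mem hgm) (mem_zpowers m)
    rwa [← hgw, hw₁, mul_one]

/-- A finite nontrivial cyclic group generated by each of its nontrivial elements has prime
order. -/
theorem prime_card_zpowers [Finite Q] {m : Q} (hm : m ≠ 1)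
    (h : ∀ r ∈ zpowers m, r ≠ 1 → m ∈ zpowers r) : (Nat.card (zpowers m)).Prime := by
  rw [Nat.card_zpowers]
  have hne : orderOf m ≠ 1 := fun h₁ => hm (orderOf_eq_one_iff.1 h₁)
  have hp := Nat.minFac_prime hne
  have hord : orderOf (m ^ (orderOf m / (orderOf m).minFac)) = (orderOf m).minFac :=
    orderOf_pow_orderOf_div (orderOf_pos m).ne' (Nat.minFac_dvd _)
  have hmem := h _ (npow_mem_zpowers m _) fun h₁ => hp.ne_one (by rw [← hord, h₁, orderOf_one])
  have hdvd := orderOf_dvd_of_mem_zpowers hmem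
  rw [hord] at hdvd
  rwa [Nat.dvd_antisymm hdvd (Nat.minFac_dvd _)]

theorem PairExchange.exists_minimal_normal_complement [Finite Q] [Group.IsSolvable Q]
    (hQ : PairExchange Q) (hgen : ∃ x y : Q, GeneratingPair x y) (hfrat : frattini Q = ⊥)
    (hna : ¬ ∀ a b : Q, a * b = b * a) :
    ∃ (V : Subgroup Q) (m : Q), IsMinimalNormal V ∧ V.IsComplement' (zpowers m) ∧
      (Nat.card (zpowers m)).Prime ∧ ∀ h ∈ zpowers m, (∀ v ∈ V, h * v = v * h) → h = 1 := by
  have hcenter := hQ.center_eq_bot hgen hfrat hna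
  have htop : (⊤ : Subgroup Q) ≠ ⊥ := fun h => hna fun a b => by
    have htriv : ∀ g : Q, g = 1 := fun g => mem_bot.1 (h ▸ mem_top g)
    rw [htriv a, htriv b]
  obtain ⟨V, -, hV⟩ := exists_isMinimalNormal_le inferInstance htop
  have := hV.normal
  obtain ⟨M, hM, hVM⟩ := exists_isCoatom_not_le_of_frattini_eq_bot hfrat hV.ne_bot
  have hcompl := hV.isComplement'_of_isCoatom hV.commute hM hVM
  have := hQ.isCyclic_quotient hgen hV hV.commute hcompl
  have : IsCyclic M := isCyclic_of_surjective hcompl.QuotientMulEquiv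
    hcompl.QuotientMulEquiv.surjective
  obtain ⟨m, rfl⟩ := (Subgroup.isCyclic_iff_exists_zpowers_eq_top M).1 this
  refine ⟨V, m, hV, hcompl.symm, prime_card_zpowers ?_ ?_, fun r hr hcomm => ?_⟩
  · rintro rfl
    refine hna fun a b => ?_
    have hVtop : V = ⊤ := by simpa using hcompl.sup_eq_top
    exact hV.commute a (hVtop ▸ mem_top a) b (hVtop ▸ mem_top b)
  · exact fun r hr hr₁ => hQ.mem_zpowers_of_isCoatom hcenter hV.ne_bot hM hcompl hr hr₁
  · rw [← mem_bot, ← hcenter, mem_center_iff]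
    intro g
    obtain ⟨a, ha, v, hv, rfl⟩ := mem_sup_of_normal_right.1 (hcompl.sup_eq_top ▸ mem_top g)
    have har : Commute r a := by
      obtain ⟨k, rfl⟩ := mem_zpowers_iff.1 hr
      obtain ⟨l, rfl⟩ := mem_zpowers_iff.1 ha
      exact Commute.zpow_zpow_self m k l
    exact (har.mul_right (hcomm v hv)).eq.symm

end Structure

end Auxiliary

/-- If a 2-generated solvable non-nilpotent finite group `G` satisfies the MGSE
property, then `Q = G/Frat(G) ≅ V ⋊ ⟨x⟩`, where `x` has prime order and `V` is a
faithful irreducible `⟨x⟩`-module: `Q` has an abelian minimal normal subgroup `V`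
with a complement `H = ⟨x⟩` cyclic of prime order satisfying `C_H(V) = 1`. -/
theorem mgse_two_generated_structure {G : Type*} [Group G] [Finite G]
    (hsol : IsSolvable G) (hnil : ¬ Group.IsNilpotent G)
    (hd : minGen G = 2) (h : MGSE G) :
    ∃ V H : Subgroup (G ⧸ frattini G),
      V.Normal ∧
      (∀ a ∈ V, ∀ b ∈ V, a * b = b * a) ∧
      V ≠ ⊥ ∧
      (∀ W : Subgroup (G ⧸ frattini G), W ≤ V → W.Normal → W = ⊥ ∨ W = V) ∧
      V.IsComplement' H ∧
      (∃ x : G ⧸ frattini G, H = Subgroup.zpowers x) ∧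
      (Nat.card H).Prime ∧
      (∀ h ∈ H, (∀ v ∈ V, h * v = v * h) → h = 1) := by
  have : Group.IsSolvable G := hsol
  obtain ⟨x, y, hxy⟩ := exists_generatingPair_of_minGen_eq_two hd
  obtain ⟨V, m, hV, hcompl, hprime, hcent⟩ :=
    (h.pairExchange hd).quotient_frattini.exists_minimal_normal_complement
      ⟨_, _, hxy.map (QuotientGroup.mk'_surjective _)⟩ frattini_quotient_frattini
      (fun hcomm => hnil (isNilpotent_of_quotient_frattini_comm hcomm))
  exact ⟨V, Subgroup.zpowers m, hV.normal, hV.commute, hV.ne_bot, hV.eq_bot_or_eq, hcompl,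
    ⟨m, rfl⟩, hprime, hcent⟩
end
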